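/- arXiv:1806.00115 — 7 statements merged into one kernel-verified Lean document; each statement's English description precedes it below -/
import Mathlib

section
/- Let T > 0, let w : [0,T] → ℝ be continuous, let b : ℝ → ℝ be continuously differentiable and Lipschitz continuous with b′(y) ≤ −M for all y ∈ ℝ, where M > 0, let σ ∈ ℝ, x ∈ ℝ and ε > 0. Let X, Y : [0,T] → ℝ be continuous maps satisfying X(t) = x + ∫₀ᵗ b(X(s)) ds + σ w(t) and Y(t) = x + ε + ∫₀ᵗ b(Y(s)) ds + σ w(t) for all t ∈ [0,T]. Then 0 < Y(s) − X(s) ≤ ε e^{−Ms} for all s ∈ [0,T]. -/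
open Set Filter MeasureTheory

theorem hasDerivAt_integral_of_continuousOn_Icc {T : ℝ} {f : ℝ → ℝ}
    (hf : ContinuousOn f (Icc 0 T)) {t : ℝ} (ht : t ∈ Ioo 0 T) :
    HasDerivAt (fun u => ∫ s in (0 : ℝ)..u, f s) (f t) t := by
  have hmem : Icc 0 T ∈ nhds t := Icc_mem_nhds ht.1 ht.2
  refine intervalIntegral.integral_hasDerivAt_right ?_ ?_ (hf.continuousAt hmem)
  · refine ContinuousOn.intervalIntegrable_of_Icc ht.1.le (hf.mono ?_)
    exact Icc_subset_Icc le_rfl ht.2.le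
  · exact ⟨Icc 0 T, hmem, hf.aestronglyMeasurable measurableSet_Icc⟩

theorem HasDerivAt.mul_exp_mul {f : ℝ → ℝ} {f' t : ℝ} (hf : HasDerivAt f f' t) (c : ℝ) :
    HasDerivAt (fun u => f u * Real.exp (c * u)) ((f' + c * f t) * Real.exp (c * t)) t := by
  have hexp : HasDerivAt (fun u => Real.exp (c * u)) (Real.exp (c * t) * (c * 1)) t :=
    ((hasDerivAt_id' t).const_mul c).exp
  exact (hf.fun_mul hexp).congr_deriv (by ring)

/-- A reverse Grönwall inequality: if `f' ≥ -c f` then `f` decays at most like `e^{-ct}`. -/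
theorem le_mul_exp_of_neg_mul_le_deriv {T c : ℝ} {f f' : ℝ → ℝ}
    (hf : ContinuousOn f (Icc 0 T)) (hf' : ∀ t ∈ Ioo 0 T, HasDerivAt f (f' t) t)
    (h : ∀ t ∈ Ioo 0 T, 0 ≤ f' t + c * f t) {t : ℝ} (ht : t ∈ Icc 0 T) :
    f 0 ≤ f t * Real.exp (c * t) := by
  have hmono : MonotoneOn (fun u => f u * Real.exp (c * u)) (Icc 0 T) := by
    refine monotoneOn_of_hasDerivWithinAt_nonneg
      (f' := fun u => (f' u + c * f u) * Real.exp (c * u)) (convex_Icc 0 T)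
      (hf.mul (by fun_prop)) ?_ ?_
    · intro u hu
      rw [interior_Icc] at hu
      exact ((hf' u hu).mul_exp_mul c).hasDerivWithinAt
    · intro u hu
      rw [interior_Icc] at hu
      exact mul_nonneg (h u hu) (Real.exp_pos _).le
  simpa using hmono (left_mem_Icc.2 (ht.1.trans ht.2)) ht ht.1

/-- Dissipativity bound: if `b' ≤ -M` with `M > 0`, two solutions of
`X(t) = X₀ + ∫₀ᵗ b(X(s)) ds + σ w(t)` with initial conditions `x` and `x + ε`
satisfy `0 < Y(s) - X(s) ≤ ε e^{-Ms}`. -/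
theorem dissipative_contraction_of_solutions
    (T : ℝ) (hT : 0 < T) (w : ℝ → ℝ) (hw : ContinuousOn w (Set.Icc 0 T))
    (b : ℝ → ℝ) (hb : ContDiff ℝ 1 b) (L : NNReal) (hblip : LipschitzWith L b)
    (M : ℝ) (hM : 0 < M) (hdiss : ∀ y : ℝ, deriv b y ≤ -M)
    (σ x ε : ℝ) (hε : 0 < ε)
    (X Y : ℝ → ℝ) (hX : ContinuousOn X (Set.Icc 0 T)) (hY : ContinuousOn Y (Set.Icc 0 T))
    (hXeq : ∀ t ∈ Set.Icc (0 : ℝ) T, X t = x + (∫ s in (0 : ℝ)..t, b (X s)) + σ * w t)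
    (hYeq : ∀ t ∈ Set.Icc (0 : ℝ) T, Y t = x + ε + (∫ s in (0 : ℝ)..t, b (Y s)) + σ * w t) :
    ∀ s ∈ Set.Icc (0 : ℝ) T, 0 < Y s - X s ∧ Y s - X s ≤ ε * Real.exp (-M * s) := by
  have h0 : (0 : ℝ) ∈ Icc 0 T := left_mem_Icc.2 hT.le
  have hcont : ContinuousOn (fun t => Y t - X t) (Icc 0 T) := hY.sub hX
  have hinit : Y 0 - X 0 = ε := by
    rw [hYeq 0 h0, hXeq 0 h0]
    simp
  have hderiv : ∀ t ∈ Ioo 0 T,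
      HasDerivAt (fun t => Y t - X t) (b (Y t) - b (X t)) t := by
    intro t ht
    have hint := ((hasDerivAt_integral_of_continuousOn_Icc
      (hb.continuous.comp_continuousOn hY) ht).sub
      (hasDerivAt_integral_of_continuousOn_Icc
      (hb.continuous.comp_continuousOn hX) ht)).const_add ε
    refine hint.congr_of_eventuallyEq ?_
    filter_upwards [Icc_mem_nhds ht.1 ht.2] with u hu
    rw [hYeq u hu, hXeq u hu]
    simp only [Pi.sub_apply, Function.comp_apply]
    ring
  have hne : ∀ t ∈ Icc 0 T, Y t - X t ≠ 0 := by
    intro t ht hzero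
    have hsq := le_mul_exp_of_neg_mul_le_deriv (c := 2 * L) (hcont.pow 2)
      (fun u hu => (hderiv u hu).pow 2) (fun u _ => by
        have hlip : |b (Y u) - b (X u)| ≤ L * |Y u - X u| := by
          simpa [Real.dist_eq] using hblip.dist_le_mul (Y u) (X u)
        have hprod : |(Y u - X u) * (b (Y u) - b (X u))| ≤ L * (Y u - X u) ^ 2 := by
          rw [abs_mul, ← sq_abs (Y u - X u)]
          nlinarith [mul_le_mul_of_nonneg_left hlip (abs_nonneg (Y u - X u))]
        have := neg_abs_le ((Y u - X u) * (b (Y u) - b (X u)))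
        simp only [Pi.pow_apply]
        norm_num
        linarith) ht
    simp only [Pi.pow_apply, hzero, hinit] at hsq
    nlinarith [pow_pos hε 2]
  have hpos : ∀ t ∈ Icc 0 T, 0 < Y t - X t := by
    intro t ht
    by_contra! hle
    obtain ⟨u, hu, hzero⟩ := intermediate_value_Icc' ht.1
      (hcont.mono (Icc_subset_Icc le_rfl ht.2)) ⟨hle, hinit ▸ hε.le⟩
    exact hne u ⟨hu.1, hu.2.trans ht.2⟩ hzero
  intro t ht
  refine ⟨hpos t ht, ?_⟩
  have hdecay := le_mul_exp_of_neg_mul_le_deriv (c := M) hcont.neg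
    (fun u hu => (hderiv u hu).neg) (fun u hu => by
      have hle : X u ≤ Y u := (sub_pos.1 (hpos u (Ioo_subset_Icc_self hu))).le
      have := image_sub_le_mul_sub_of_deriv_le (hb.differentiable one_ne_zero) hdiss hle
      simp only [Pi.neg_apply]
      linarith) ht
  simp only [Pi.neg_apply, hinit] at hdecay
  rw [neg_mul, Real.exp_neg, ← div_eq_mul_inv, le_div_iff₀ (Real.exp_pos _)]
  linarith
end

section
/- Let T > 0, let w : [0,T] → ℝ be continuous, let b : ℝ → ℝ be twice continuously differentiable and Lipschitz continuous with ‖b″‖_∞ < ∞ and b′(y) ≤ −M for all y ∈ ℝ, where M > 0, let σ ∈ ℝ, x ∈ ℝ and ε > 0. Let X, Y : [0,T] → ℝ be continuous maps satisfying X(t) = x + ∫₀ᵗ b(X(s)) ds + σ w(t) and Y(t) = x + ε + ∫₀ᵗ b(Y(s)) ds + σ w(t) for all t ∈ [0,T]. Then for all 0 ≤ v < u ≤ T, | exp(∫ᵥᵘ b′(X(r)) dr) − (Y(u) − X(u))/(Y(v) − X(v)) | ≤ (‖b″‖_∞ / (2M)) ε e^{−Mv}. -/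
open Set Filter MeasureTheory

/-- The mean of `deriv b` over the segment from `p` to `q`. -/
noncomputable def meanDeriv (b : ℝ → ℝ) (p q : ℝ) : ℝ :=
  ∫ θ in (0 : ℝ)..1, deriv b (p + θ * (q - p))

theorem continuous_meanDeriv {b X Y : ℝ → ℝ} (hb : Continuous (deriv b))
    (hX : Continuous X) (hY : Continuous Y) : Continuous fun t => meanDeriv b (X t) (Y t) := by
  unfold meanDeriv
  apply intervalIntegral.continuous_parametric_intervalIntegral_of_continuous'
  unfold Function.uncurry
  fun_prop

theorem meanDeriv_mul_sub {b : ℝ → ℝ} (hd : Differentiable ℝ b) (hb : Continuous (deriv b))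
    (p q : ℝ) : meanDeriv b p q * (q - p) = b q - b p := by
  have hderiv : ∀ θ ∈ Set.uIcc (0 : ℝ) 1,
      HasDerivAt (fun θ => b (p + θ * (q - p))) (deriv b (p + θ * (q - p)) * (q - p)) θ := by
    intro θ _
    have hline : HasDerivAt (fun θ : ℝ => p + θ * (q - p)) (q - p) θ := by
      simpa using ((hasDerivAt_id θ).mul_const (q - p)).const_add p
    exact (hd _).hasDerivAt.comp θ hline
  have h := intervalIntegral.integral_eq_sub_of_hasDerivAt hderiv
    (Continuous.intervalIntegrable (by fun_prop) _ _)
  rw [intervalIntegral.integral_mul_const] at h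
  simpa [meanDeriv] using h

theorem meanDeriv_le {b : ℝ → ℝ} (hb : Continuous (deriv b)) {c : ℝ}
    (hc : ∀ y, deriv b y ≤ c) (p q : ℝ) : meanDeriv b p q ≤ c := by
  have h := intervalIntegral.integral_mono_on (μ := volume) (a := 0) (b := 1)
    (f := fun θ => deriv b (p + θ * (q - p))) (g := fun _ => c) zero_le_one
    (Continuous.intervalIntegrable (by fun_prop) _ _)
    (Continuous.intervalIntegrable (by fun_prop) _ _) (fun θ _ => hc _)
  simpa [meanDeriv] using h

theorem abs_deriv_sub_meanDeriv_le {b : ℝ → ℝ} (hd : Differentiable ℝ (deriv b)) {K : ℝ}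
    (hK : ∀ y, |deriv (deriv b) y| ≤ K) (p q : ℝ) :
    |deriv b p - meanDeriv b p q| ≤ K / 2 * |q - p| := by
  have hb := hd.continuous
  have hsub : meanDeriv b p q - deriv b p =
      ∫ θ in (0 : ℝ)..1, (deriv b (p + θ * (q - p)) - deriv b p) := by
    rw [intervalIntegral.integral_sub (Continuous.intervalIntegrable (by fun_prop) _ _)
      (Continuous.intervalIntegrable (by fun_prop) _ _)]
    simp [meanDeriv]
  rw [abs_sub_comm, hsub, ← Real.norm_eq_abs]
  calc ‖∫ θ in (0 : ℝ)..1, (deriv b (p + θ * (q - p)) - deriv b p)‖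
      ≤ ∫ θ in (0 : ℝ)..1, K * |q - p| * θ := by
        refine intervalIntegral.norm_integral_le_of_norm_le zero_le_one
          (Filter.Eventually.of_forall fun θ hθ => ?_)
          (Continuous.intervalIntegrable (by fun_prop) _ _)
        have h := convex_univ.norm_image_sub_le_of_norm_deriv_le (f := deriv b)
          (fun y _ => hd y) (fun y _ => hK y) (mem_univ p) (mem_univ (p + θ * (q - p)))
        rw [add_sub_cancel_left, norm_mul, Real.norm_of_nonneg hθ.1.le,
          Real.norm_eq_abs (q - p)] at h
        linarith
    _ = K / 2 * |q - p| := by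
        rw [intervalIntegral.integral_const_mul, integral_id]
        ring

/-- The linear integral equation `D t = c + ∫₀ᵗ a D` is solved by the exponential. -/
theorem eq_mul_exp_of_integral_eq {a D : ℝ → ℝ} (ha : Continuous a) (hD : Continuous D)
    {T c : ℝ} (h : ∀ t ∈ Set.Icc (0 : ℝ) T, D t = c + ∫ s in (0 : ℝ)..t, a s * D s) :
    ∀ t ∈ Set.Icc (0 : ℝ) T, D t = c * Real.exp (∫ s in (0 : ℝ)..t, a s) := by
  set E : ℝ → ℝ := fun t => c + ∫ s in (0 : ℝ)..t, a s * D s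
  set A : ℝ → ℝ := fun t => ∫ s in (0 : ℝ)..t, a s
  have hE : ∀ t, HasDerivAt E (a t * D t) t := fun t =>
    ((ha.mul hD).integral_hasStrictDerivAt 0 t).hasDerivAt.const_add c
  have hA : ∀ t, HasDerivAt A (a t) t := fun t =>
    (ha.integral_hasStrictDerivAt 0 t).hasDerivAt
  have hF : ∀ t, HasDerivAt (fun t => E t * Real.exp (-A t))
      (a t * D t * Real.exp (-A t) + E t * (Real.exp (-A t) * -a t)) t :=
    fun t => (hE t).mul (hA t).neg.exp
  have hconst := constant_of_has_deriv_right_zero (a := 0) (b := T)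
    (f := fun t => E t * Real.exp (-A t))
    (fun t _ => (hF t).continuousAt.continuousWithinAt) (fun t ht => by
      have hz : a t * D t * Real.exp (-A t) + E t * (Real.exp (-A t) * -a t) = 0 := by
        have : D t = E t := h t (Ico_subset_Icc_self ht)
        rw [this]; ring
      exact hz ▸ (hF t).hasDerivWithinAt)
  intro t ht
  have ht' : E t * Real.exp (-A t) = c := by simpa [E, A] using hconst t ht
  calc D t = E t := h t ht
    _ = E t * Real.exp (-A t) * Real.exp (A t) := by
        rw [mul_assoc, ← Real.exp_add, neg_add_cancel, Real.exp_zero, mul_one]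
    _ = c * Real.exp (A t) := by rw [ht']

theorem abs_exp_sub_exp_le_of_nonpos {s t : ℝ} (hs : s ≤ 0) (ht : t ≤ 0) :
    |Real.exp s - Real.exp t| ≤ |s - t| := by
  have h := (convex_Iic (0 : ℝ)).norm_image_sub_le_of_norm_deriv_le (f := Real.exp) (C := 1)
    (fun y _ => Real.differentiableAt_exp)
    (fun y hy => by simpa using hy) (mem_Iic.2 ht) (mem_Iic.2 hs)
  simpa using h

/-- The flow-ratio estimate for paths that are continuous on the whole line. -/
theorem abs_exp_integral_deriv_sub_ratio_le {b X Y : ℝ → ℝ} {T K M ε : ℝ}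
    (hb : ContDiff ℝ 2 b) (hK : ∀ y, |deriv (deriv b) y| ≤ K) (hM : 0 < M)
    (hdiss : ∀ y, deriv b y ≤ -M) (hε : 0 < ε) (hX : Continuous X) (hY : Continuous Y)
    (hXY : ∀ t ∈ Set.Icc (0 : ℝ) T, Y t - X t = ε + ∫ s in (0 : ℝ)..t, (b (Y s) - b (X s)))
    {v u : ℝ} (hv : v ∈ Set.Icc (0 : ℝ) T) (hu : u ∈ Set.Icc (0 : ℝ) T) (hvu : v ≤ u) :
    |Real.exp (∫ r in v..u, deriv b (X r)) - (Y u - X u) / (Y v - X v)| ≤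
      K / (2 * M) * ε * Real.exp (-M * v) := by
  have hb' : ContDiff ℝ 1 (deriv b) := ((contDiff_succ_iff_deriv (n := 1)).1 hb).2.2
  have hd : Differentiable ℝ b := hb.differentiable (by norm_num)
  have hd' : Differentiable ℝ (deriv b) := hb'.differentiable (by norm_num)
  have hc' : Continuous (deriv b) := hd'.continuous
  have hK0 : 0 ≤ K := (abs_nonneg _).trans (hK 0)
  set a : ℝ → ℝ := fun t => meanDeriv b (X t) (Y t) with ha_def
  have ha : Continuous a := continuous_meanDeriv hc' hX hY
  have haM : ∀ t, a t ≤ -M := fun t => meanDeriv_le hc' hdiss _ _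
  have hint : ∀ s t, IntervalIntegrable a volume s t := fun s t => ha.intervalIntegrable s t
  have hbX : Continuous fun t => deriv b (X t) := hc'.comp hX
  have hsol := eq_mul_exp_of_integral_eq (D := fun t => Y t - X t) ha (hY.sub hX) (T := T) (c := ε)
    (fun t ht => by simpa only [ha_def, meanDeriv_mul_sub hd hc'] using hXY t ht)
  have hdecay : ∀ t ∈ Set.Icc (0 : ℝ) T, |Y t - X t| ≤ ε * Real.exp (-M * t) := by
    intro t ht
    rw [hsol t ht, abs_of_pos (by positivity)]
    gcongr
    have h := intervalIntegral.integral_mono_on (μ := volume) ht.1 (hint 0 t)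
      (intervalIntegrable_const (c := -M)) (fun s _ => haM s)
    simp only [intervalIntegral.integral_const, smul_eq_mul] at h
    linarith
  have hratio : (Y u - X u) / (Y v - X v) = Real.exp (∫ r in v..u, a r) := by
    rw [hsol u hu, hsol v hv, mul_div_mul_left _ _ hε.ne', ← Real.exp_sub,
      intervalIntegral.integral_interval_sub_left (hint _ _) (hint _ _)]
  have hnonpos : ∀ f : ℝ → ℝ, (∀ r, f r ≤ -M) → ∫ r in v..u, f r ≤ 0 := by
    intro f hf
    rw [intervalIntegral.integral_of_le hvu]
    exact integral_nonpos fun r => (hf r).trans (by simpa using hM.le)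
  have hexp : ∫ r in v..u, Real.exp (-M * r) =
      (Real.exp (-M * v) - Real.exp (-M * u)) / M := by
    rw [intervalIntegral.integral_comp_mul_left (fun r => Real.exp r) (neg_ne_zero.2 hM.ne'),
      integral_exp, smul_eq_mul]
    field_simp
    ring
  rw [hratio]
  calc |Real.exp (∫ r in v..u, deriv b (X r)) - Real.exp (∫ r in v..u, a r)|
      ≤ |(∫ r in v..u, deriv b (X r)) - ∫ r in v..u, a r| :=
        abs_exp_sub_exp_le_of_nonpos (hnonpos _ fun r => hdiss _) (hnonpos _ haM)
    _ = ‖∫ r in v..u, (deriv b (X r) - a r)‖ := by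
        rw [intervalIntegral.integral_sub (hbX.intervalIntegrable _ _) (hint _ _),
          Real.norm_eq_abs]
    _ ≤ ∫ r in v..u, K / 2 * ε * Real.exp (-M * r) := by
        refine intervalIntegral.norm_integral_le_of_norm_le hvu
          (Filter.Eventually.of_forall fun r hr => ?_)
          (Continuous.intervalIntegrable (by fun_prop) _ _)
        calc |deriv b (X r) - a r| ≤ K / 2 * |Y r - X r| :=
              abs_deriv_sub_meanDeriv_le hd' hK _ _
          _ ≤ K / 2 * (ε * Real.exp (-M * r)) := by
              gcongr
              exact hdecay r ⟨hv.1.trans hr.1.le, hr.2.trans hu.2⟩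
          _ = K / 2 * ε * Real.exp (-M * r) := by ring
    _ = K / (2 * M) * ε * (Real.exp (-M * v) - Real.exp (-M * u)) := by
        rw [intervalIntegral.integral_const_mul, hexp]
        field_simp
    _ ≤ K / (2 * M) * ε * Real.exp (-M * v) := by
        gcongr
        linarith [Real.exp_pos (-M * u)]

/-- The ratio `(Y(u) - X(u))/(Y(v) - X(v))` of differences of two solutions approximates
the flow-derivative ratio `exp(∫ᵥᵘ b'(X(r)) dr)` up to `(‖b''‖_∞/(2M)) ε e^{-Mv}`. -/
theorem flow_ratio_approximation
    (T : ℝ) (hT : 0 < T) (w : ℝ → ℝ) (hw : ContinuousOn w (Set.Icc 0 T))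
    (b : ℝ → ℝ) (hb : ContDiff ℝ 2 b) (L : NNReal) (hblip : LipschitzWith L b)
    (Kb : ℝ) (hKb : ∀ y : ℝ, |deriv (deriv b) y| ≤ Kb)
    (M : ℝ) (hM : 0 < M) (hdiss : ∀ y : ℝ, deriv b y ≤ -M)
    (σ x ε : ℝ) (hε : 0 < ε)
    (X Y : ℝ → ℝ) (hX : ContinuousOn X (Set.Icc 0 T)) (hY : ContinuousOn Y (Set.Icc 0 T))
    (hXeq : ∀ t ∈ Set.Icc (0 : ℝ) T, X t = x + (∫ s in (0 : ℝ)..t, b (X s)) + σ * w t)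
    (hYeq : ∀ t ∈ Set.Icc (0 : ℝ) T, Y t = x + ε + (∫ s in (0 : ℝ)..t, b (Y s)) + σ * w t) :
    ∀ v ∈ Set.Icc (0 : ℝ) T, ∀ u ∈ Set.Icc (0 : ℝ) T, v < u →
      |Real.exp (∫ r in v..u, deriv b (X r)) - (Y u - X u) / (Y v - X v)| ≤
        Kb / (2 * M) * ε * Real.exp (-M * v) := by
  intro v hv u hu hvu
  set X' : ℝ → ℝ := Set.IccExtend hT.le ((Set.Icc 0 T).domRestrict X)
  set Y' : ℝ → ℝ := Set.IccExtend hT.le ((Set.Icc 0 T).domRestrict Y)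
  have hX' : Continuous X' := hX.domRestrict.Icc_extend'
  have hY' : Continuous Y' := hY.domRestrict.Icc_extend'
  have hXX : ∀ t ∈ Set.Icc (0 : ℝ) T, X' t = X t := fun t ht => Set.IccExtend_of_mem _ _ ht
  have hYY : ∀ t ∈ Set.Icc (0 : ℝ) T, Y' t = Y t := fun t ht => Set.IccExtend_of_mem _ _ ht
  have hcongr : ∀ (f Z Z' : ℝ → ℝ), (∀ t ∈ Set.Icc (0 : ℝ) T, Z' t = Z t) →
      ∀ s ∈ Set.Icc (0 : ℝ) T, ∀ t ∈ Set.Icc (0 : ℝ) T,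
        ∫ r in s..t, f (Z r) = ∫ r in s..t, f (Z' r) := fun f Z Z' hZ s hs t ht =>
    intervalIntegral.integral_congr fun r hr =>
      congrArg f (hZ r (Set.uIcc_subset_Icc hs ht hr)).symm
  have h0 : (0 : ℝ) ∈ Set.Icc 0 T := ⟨le_rfl, hT.le⟩
  have hbX : Continuous fun t => b (X' t) := hblip.continuous.comp hX'
  have hbY : Continuous fun t => b (Y' t) := hblip.continuous.comp hY'
  have hXY : ∀ t ∈ Set.Icc (0 : ℝ) T,
      Y' t - X' t = ε + ∫ s in (0 : ℝ)..t, (b (Y' s) - b (X' s)) := by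
    intro t ht
    rw [intervalIntegral.integral_sub (hbY.intervalIntegrable _ _)
      (hbX.intervalIntegrable _ _), hXX t ht, hYY t ht, hXeq t ht,
      hYeq t ht, hcongr b X X' hXX 0 h0 t ht, hcongr b Y Y' hYY 0 h0 t ht]
    ring
  rw [hcongr (deriv b) X X' hXX v hv u hu, ← hXX u hu, ← hXX v hv, ← hYY u hu, ← hYY v hv]
  exact abs_exp_integral_deriv_sub_ratio_le hb hKb hM hdiss hε hX' hY' hXY hv hu hvu.le
end

section
/- Let T > 0, let w : [0,T] → ℝ be continuous, let b : ℝ → ℝ be twice continuously differentiable and Lipschitz continuous with ‖b″‖_∞ < ∞ and b′(y) ≤ −M for all y ∈ ℝ, where M > 0, let σ ∈ ℝ, x ∈ ℝ, ε > 0 and H ∈ (1/2,1). Let X, Y : [0,T] → ℝ be continuous maps satisfying X(t) = x + ∫₀ᵗ b(X(s)) ds + σ w(t) and Y(t) = x + ε + ∫₀ᵗ b(Y(s)) ds + σ w(t). Then for every continuously differentiable φ : ℝ → ℝ with ‖φ′‖_∞ < ∞ and every t ∈ (0,T], H(2H−1) σ² ∫₀ᵗ ∫₀ᵘ |φ′(X(u))|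 · | exp(∫ᵥᵘ b′(X(r)) dr) − (Y(u) − X(u))/(Y(v) − X(v)) | (u − v)^{2H−2} dv du ≤ C_φ ε t^{2H−1}, where C_φ := H σ² ‖b″‖_∞ ‖φ′‖_∞ / (2M²). -/
open Set Filter MeasureTheory

lemma abs_exp_sub_exp_le_exp_mul {p q c : ℝ} (hp : p ≤ c) (hq : q ≤ c) :
    |Real.exp p - Real.exp q| ≤ Real.exp c * |p - q| := by
  have h := Convex.norm_image_sub_le_of_norm_hasDerivWithin_le (𝕜 := ℝ) (f := Real.exp)
    (f' := Real.exp) (s := Iic c) (x := q) (y := p) (C := Real.exp c)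
    (fun z _ => (Real.hasDerivAt_exp z).hasDerivWithinAt)
    (fun z hz => by simpa using hz) (convex_Iic c) hq hp
  simpa only [Real.norm_eq_abs] using h

/-- First-order Taylor estimate with a bound on the second derivative. -/
lemma abs_sub_sub_deriv_mul_le {b : ℝ → ℝ} (hb : ContDiff ℝ 2 b) {K : ℝ}
    (hK : ∀ y, |deriv (deriv b) y| ≤ K) {p q : ℝ} (hpq : p ≤ q) :
    |b q - b p - deriv b p * (q - p)| ≤ K / 2 * (q - p) ^ 2 := by
  have hdb : Differentiable ℝ b := hb.differentiable (by norm_num)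
  have hddb : Differentiable ℝ (deriv b) :=
    ((contDiff_succ_iff_deriv (n := 1)).1 hb).2.2.differentiable (by norm_num)
  have h1 (z : ℝ) (hz : p ≤ z) : |deriv b z - deriv b p| ≤ K * (z - p) := by
    have h := Convex.norm_image_sub_le_of_norm_deriv_le (𝕜 := ℝ) (f := deriv b) (s := univ)
      (x := p) (y := z) (C := K) (fun y _ => hddb y) (fun y _ => hK y) convex_univ trivial trivial
    simpa only [Real.norm_eq_abs, abs_of_nonneg (sub_nonneg.2 hz)] using h
  have hder (z : ℝ) : HasDerivAt (fun z => b z - b p - deriv b p * (z - p))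
      (deriv b z - deriv b p) z := by
    refine (((hdb z).hasDerivAt.sub_const (b p)).sub
      (((hasDerivAt_id' z).sub_const p).const_mul (deriv b p))).congr_deriv ?_
    ring
  have hB (z : ℝ) : HasDerivAt (fun z => K / 2 * (z - p) ^ 2) (K * (z - p)) z := by
    refine ((((hasDerivAt_id' z).sub_const p).pow 2).const_mul (K / 2)).congr_deriv ?_
    push_cast
    ring
  exact image_norm_le_of_norm_deriv_right_le_deriv_boundary
    (fun z _ => (hder z).continuousAt.continuousWithinAt)
    (fun z _ => (hder z).hasDerivWithinAt) (by simp) hB (fun z hz => h1 z hz.1) ⟨hpq, le_rfl⟩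

lemma intervalIntegral_mono_of_nonneg {f g : ℝ → ℝ} {p q : ℝ} (hpq : p ≤ q)
    (hf : ∀ x ∈ Ioc p q, 0 ≤ f x) (hg : IntervalIntegrable g volume p q)
    (hfg : ∀ x ∈ Ioc p q, f x ≤ g x) : ∫ x in p..q, f x ≤ ∫ x in p..q, g x := by
  rw [intervalIntegral.integral_of_le hpq, intervalIntegral.integral_of_le hpq]
  exact integral_mono_of_nonneg (ae_restrict_of_forall_mem measurableSet_Ioc hf)
    ((intervalIntegrable_iff_integrableOn_Ioc_of_le hpq).1 hg)
    (ae_restrict_of_forall_mem measurableSet_Ioc hfg)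

lemma hasDerivAt_sub_of_integral_eq {T σ x y : ℝ} {w b X Y : ℝ → ℝ} (hb : Continuous b)
    (hX : ContinuousOn X (Icc 0 T)) (hY : ContinuousOn Y (Icc 0 T))
    (hXeq : ∀ t ∈ Icc (0 : ℝ) T, X t = x + (∫ s in (0 : ℝ)..t, b (X s)) + σ * w t)
    (hYeq : ∀ t ∈ Icc (0 : ℝ) T, Y t = y + (∫ s in (0 : ℝ)..t, b (Y s)) + σ * w t)
    {t : ℝ} (ht : t ∈ Ioo 0 T) :
    HasDerivAt (fun s => Y s - X s) (b (Y t) - b (X t)) t := by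
  have key {Z : ℝ → ℝ} (hZ : ContinuousOn Z (Icc 0 T)) :
      HasDerivAt (fun s => ∫ r in (0 : ℝ)..s, b (Z r)) (b (Z t)) t := by
    have hc : ContinuousOn (fun r => b (Z r)) (Icc 0 T) := hb.comp_continuousOn hZ
    refine intervalIntegral.integral_hasDerivAt_right ?_ ?_
      (hc.continuousAt (Icc_mem_nhds ht.1 ht.2))
    · exact (hc.mono (Icc_subset_Icc_right ht.2.le)).intervalIntegrable_of_Icc ht.1.le
    · exact (hc.mono Ioo_subset_Icc_self).stronglyMeasurableAtFilter isOpen_Ioo t ht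
  have h := ((key hY).sub (key hX)).add_const (y - x)
  refine h.congr_of_eventuallyEq ?_
  filter_upwards [Icc_mem_nhds ht.1 ht.2] with s hs
  rw [hXeq s hs, hYeq s hs]
  simp only [Pi.sub_apply]
  ring

/-- The gap between two solutions driven by the same path stays positive. -/
lemma gap_pos {T : ℝ} {b X Y : ℝ → ℝ} {L : NNReal} (hb : LipschitzWith L b)
    (hX : ContinuousOn X (Icc 0 T)) (hY : ContinuousOn Y (Icc 0 T))
    (hD : ∀ s ∈ Ioo 0 T, HasDerivAt (fun s => Y s - X s) (b (Y s) - b (X s)) s)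
    (h0 : 0 < Y 0 - X 0) {t : ℝ} (ht : t ∈ Icc 0 T) : 0 < Y t - X t := by
  have hc : ContinuousOn (fun s => Y s - X s) (Icc 0 T) := hY.sub hX
  have hder (s : ℝ) (hs : s ∈ Ioo 0 T) :
      HasDerivAt (fun s => Real.exp (2 * L * s) * (Y s - X s) ^ 2)
        (Real.exp (2 * L * s) *
          (2 * L * (Y s - X s) ^ 2 + 2 * (Y s - X s) * (b (Y s) - b (X s)))) s := by
    have hE : HasDerivAt (fun s : ℝ => Real.exp (2 * L * s)) (Real.exp (2 * L * s) * (2 * L)) s := by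
      simpa using ((hasDerivAt_id s).const_mul (2 * (L : ℝ))).exp
    refine (hE.mul ((hD s hs).pow 2)).congr_deriv ?_
    push_cast [Pi.pow_apply]
    ring
  have hmono : MonotoneOn (fun s => Real.exp (2 * L * s) * (Y s - X s) ^ 2) (Icc 0 T) := by
    refine monotoneOn_of_deriv_nonneg (convex_Icc 0 T) ?_ ?_ ?_
    · exact (by fun_prop : Continuous fun s : ℝ => Real.exp (2 * L * s)).continuousOn.mul (hc.pow 2)
    · rw [interior_Icc]
      exact fun s hs => (hder s hs).differentiableAt.differentiableWithinAt
    · rw [interior_Icc]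
      intro s hs
      rw [(hder s hs).deriv]
      have hl : |b (Y s) - b (X s)| ≤ L * |Y s - X s| := by
        simpa [Real.dist_eq] using hb.dist_le_mul (Y s) (X s)
      have hm : |(Y s - X s) * (b (Y s) - b (X s))| ≤ L * (Y s - X s) ^ 2 := by
        rw [abs_mul, ← sq_abs (Y s - X s)]
        nlinarith [mul_le_mul_of_nonneg_left hl (abs_nonneg (Y s - X s))]
      have := (abs_le.1 hm).1
      exact mul_nonneg (Real.exp_pos _).le (by nlinarith)
  have hne (s : ℝ) (hs : s ∈ Icc 0 T) : Y s - X s ≠ 0 := by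
    intro hz
    have h := hmono (left_mem_Icc.2 (hs.1.trans hs.2)) hs hs.1
    simp only [hz] at h
    simp at h
    nlinarith [pow_pos h0 2]
  by_contra! hn
  obtain ⟨s, hs, hs0⟩ := intermediate_value_Icc' ht.1
    (hc.mono (Icc_subset_Icc_right ht.2)) (show (0 : ℝ) ∈ Icc _ _ from ⟨hn, h0.le⟩)
  exact hne s ⟨hs.1, hs.2.trans ht.2⟩ hs0

/-- The gap contracts exponentially under a dissipative drift. -/
lemma gap_le_exp {T M : ℝ} {b X Y : ℝ → ℝ} (hb : Differentiable ℝ b)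
    (hdiss : ∀ y, deriv b y ≤ -M)
    (hX : ContinuousOn X (Icc 0 T)) (hY : ContinuousOn Y (Icc 0 T))
    (hD : ∀ s ∈ Ioo 0 T, HasDerivAt (fun s => Y s - X s) (b (Y s) - b (X s)) s)
    (hpos : ∀ s ∈ Icc 0 T, 0 < Y s - X s) {t : ℝ} (ht : t ∈ Icc 0 T) :
    Y t - X t ≤ (Y 0 - X 0) * Real.exp (-(M * t)) := by
  have hder (s : ℝ) (hs : s ∈ Ioo 0 T) :
      HasDerivAt (fun s => Real.exp (M * s) * (Y s - X s))
        (Real.exp (M * s) * (M * (Y s - X s) + (b (Y s) - b (X s)))) s := by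
    have hE : HasDerivAt (fun s : ℝ => Real.exp (M * s)) (Real.exp (M * s) * M) s := by
      simpa using ((hasDerivAt_id s).const_mul M).exp
    refine (hE.mul (hD s hs)).congr_deriv ?_
    ring
  have hanti : AntitoneOn (fun s => Real.exp (M * s) * (Y s - X s)) (Icc 0 T) := by
    refine antitoneOn_of_deriv_nonpos (convex_Icc 0 T) ?_ ?_ ?_
    · exact (by fun_prop : Continuous fun s : ℝ => Real.exp (M * s)).continuousOn.mul (hY.sub hX)
    · rw [interior_Icc]
      exact fun s hs => (hder s hs).differentiableAt.differentiableWithinAt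
    · rw [interior_Icc]
      intro s hs
      rw [(hder s hs).deriv]
      have h := image_sub_le_mul_sub_of_deriv_le hb hdiss
        (sub_pos.1 (hpos s (Ioo_subset_Icc_self hs))).le
      exact mul_nonpos_of_nonneg_of_nonpos (Real.exp_pos _).le (by linarith)
  have h := hanti (left_mem_Icc.2 (ht.1.trans ht.2)) ht ht.1
  simp only [mul_zero, Real.exp_zero, one_mul] at h
  rw [Real.exp_neg, ← div_eq_mul_inv, le_div_iff₀ (Real.exp_pos _)]
  linarith

/-- Replacing the flow derivative by a ratio of finite differences costs at most
`K ε e^{-Mu} / (2M)`. -/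
lemma abs_exp_integral_sub_ratio_le {T K M : ℝ} {b X Y : ℝ → ℝ} (hb : ContDiff ℝ 2 b)
    (hK : ∀ y, |deriv (deriv b) y| ≤ K) (hM : 0 < M) (hdiss : ∀ y, deriv b y ≤ -M)
    (hX : ContinuousOn X (Icc 0 T)) (hY : ContinuousOn Y (Icc 0 T))
    (hD : ∀ s ∈ Ioo 0 T, HasDerivAt (fun s => Y s - X s) (b (Y s) - b (X s)) s)
    (hpos : ∀ s ∈ Icc 0 T, 0 < Y s - X s) {u v : ℝ} (hv : 0 ≤ v) (hvu : v ≤ u) (hu : u ≤ T) :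
    |Real.exp (∫ r in v..u, deriv b (X r)) - (Y u - X u) / (Y v - X v)| ≤
      K * (Y 0 - X 0) / (2 * M) * Real.exp (-(M * u)) := by
  have hdb : Differentiable ℝ b := hb.differentiable (by norm_num)
  have hK0 : 0 ≤ K := (abs_nonneg _).trans (hK 0)
  have hsub : Icc v u ⊆ Icc 0 T := Icc_subset_Icc hv hu
  have hvT : v ∈ Icc 0 T := hsub (left_mem_Icc.2 hvu)
  have huT : u ∈ Icc 0 T := hsub (right_mem_Icc.2 hvu)
  have h0T : (0 : ℝ) ∈ Icc 0 T := left_mem_Icc.2 (hv.trans (hvu.trans hu))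
  set a : ℝ → ℝ := fun r => (b (Y r) - b (X r)) / (Y r - X r) with ha
  have hcD : ContinuousOn (fun r => Y r - X r) (Icc v u) := (hY.sub hX).mono hsub
  have hca : ContinuousOn a (Icc v u) :=
    (((hb.continuous.comp_continuousOn hY).sub (hb.continuous.comp_continuousOn hX)).mono
      hsub).div hcD fun r hr => (hpos r (hsub hr)).ne'
  have hcb : ContinuousOn (fun r => deriv b (X r)) (Icc v u) :=
    (hb.continuous_deriv (by norm_num)).comp_continuousOn (hX.mono hsub)
  have hia : IntervalIntegrable a volume v u := hca.intervalIntegrable_of_Icc hvu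
  have hib : IntervalIntegrable (fun r => deriv b (X r)) volume v u :=
    hcb.intervalIntegrable_of_Icc hvu
  have hlog : ∫ r in v..u, a r = Real.log (Y u - X u) - Real.log (Y v - X v) := by
    refine intervalIntegral.integral_eq_sub_of_hasDerivAt_of_le
      (f := fun r => Real.log (Y r - X r)) hvu
      (hcD.log fun r hr => (hpos r (hsub hr)).ne') (fun r hr => ?_) hia
    exact (hD r ⟨hv.trans_lt hr.1, hr.2.trans_le hu⟩).log
      (hpos r (hsub (Ioo_subset_Icc_self hr))).ne'
  have hratio : (Y u - X u) / (Y v - X v) = Real.exp (∫ r in v..u, a r) := by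
    rw [hlog, Real.exp_sub, Real.exp_log (hpos u huT), Real.exp_log (hpos v hvT)]
  have hle {f : ℝ → ℝ} (hi : IntervalIntegrable f volume v u) (hf : ∀ r ∈ Icc v u, f r ≤ -M) :
      ∫ r in v..u, f r ≤ -(M * (u - v)) := by
    refine (intervalIntegral.integral_mono_on hvu hi intervalIntegrable_const hf).trans_eq ?_
    simp only [intervalIntegral.integral_const, smul_eq_mul]
    ring
  have haM (r : ℝ) (hr : r ∈ Icc v u) : a r ≤ -M := by
    have hp := hpos r (hsub hr)
    rw [ha, div_le_iff₀ hp]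
    exact image_sub_le_mul_sub_of_deriv_le hdb hdiss (sub_pos.1 hp).le
  have hexpi : ∫ r in v..u, K * (Y 0 - X 0) / 2 * Real.exp (-(M * r)) =
      K * (Y 0 - X 0) / (2 * M) * (Real.exp (-(M * v)) - Real.exp (-(M * u))) := by
    have h (r : ℝ) : HasDerivAt
        (fun r => -(K * (Y 0 - X 0) / (2 * M)) * Real.exp (-(M * r)))
        (K * (Y 0 - X 0) / 2 * Real.exp (-(M * r))) r := by
      refine (((hasDerivAt_id' r).const_mul M).fun_neg.exp.const_mul
        (-(K * (Y 0 - X 0) / (2 * M)))).congr_deriv ?_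
      field_simp
    rw [intervalIntegral.integral_eq_sub_of_hasDerivAt (fun r _ => h r)
      ((by fun_prop : Continuous fun r : ℝ =>
        K * (Y 0 - X 0) / 2 * Real.exp (-(M * r))).intervalIntegrable _ _)]
    ring
  have hdiff : |(∫ r in v..u, deriv b (X r)) - ∫ r in v..u, a r| ≤
      K * (Y 0 - X 0) / (2 * M) * (Real.exp (-(M * v)) - Real.exp (-(M * u))) := by
    rw [← hexpi, ← intervalIntegral.integral_sub hib hia, ← Real.norm_eq_abs]
    refine intervalIntegral.norm_integral_le_of_norm_le hvu (ae_of_all _ fun r hr => ?_)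
      ((by fun_prop : Continuous fun r : ℝ =>
        K * (Y 0 - X 0) / 2 * Real.exp (-(M * r))).intervalIntegrable _ _)
    have hrT := hsub (Ioc_subset_Icc_self hr)
    have hp := hpos r hrT
    have ht := abs_sub_sub_deriv_mul_le hb hK (sub_pos.1 hp).le
    have heq : deriv b (X r) - a r =
        -(b (Y r) - b (X r) - deriv b (X r) * (Y r - X r)) / (Y r - X r) := by
      rw [ha]
      field_simp
      ring
    rw [heq, Real.norm_eq_abs, abs_div, abs_neg, abs_of_pos hp, div_le_iff₀ hp]
    have hg := mul_le_mul_of_nonneg_left (gap_le_exp hdb hdiss hX hY hD hpos hrT)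
      (mul_nonneg (div_nonneg hK0 two_pos.le) hp.le)
    calc _ ≤ _ := ht
      _ = K / 2 * (Y r - X r) * (Y r - X r) := by ring
      _ ≤ _ := hg
      _ = _ := by ring
  have hC : 0 ≤ K * (Y 0 - X 0) / (2 * M) :=
    div_nonneg (mul_nonneg hK0 (hpos 0 h0T).le) (by positivity)
  rw [hratio]
  calc _ ≤ Real.exp (-(M * (u - v))) * |(∫ r in v..u, deriv b (X r)) - ∫ r in v..u, a r| :=
        abs_exp_sub_exp_le_exp_mul (hle hib fun r _ => hdiss _) (hle hia haM)
    _ ≤ Real.exp (-(M * (u - v))) * (K * (Y 0 - X 0) / (2 * M) * Real.exp (-(M * v))) := by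
        refine mul_le_mul_of_nonneg_left (hdiff.trans ?_) (Real.exp_pos _).le
        exact mul_le_mul_of_nonneg_left (sub_le_self _ (Real.exp_pos _).le) hC
    _ = _ := by
        rw [mul_left_comm, ← Real.exp_add]
        ring_nf

/-- Deterministic control of the error between the Skorokhod integral correction term and its
computable approximation: the double integral of
`|φ'(X(u))| · |exp(∫ᵥᵘ b'(X(r)) dr) - (Y(u)-X(u))/(Y(v)-X(v))| (u-v)^{2H-2}`
is bounded by `C_φ ε t^{2H-1}` with `C_φ = H σ² ‖b''‖_∞ ‖φ'‖_∞ / (2M²)`. -/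
theorem skorokhod_approximation_error_bound
    (T : ℝ) (hT : 0 < T) (w : ℝ → ℝ) (hw : ContinuousOn w (Set.Icc 0 T))
    (b : ℝ → ℝ) (hb : ContDiff ℝ 2 b) (L : NNReal) (hblip : LipschitzWith L b)
    (Kb : ℝ) (hKb : ∀ y : ℝ, |deriv (deriv b) y| ≤ Kb)
    (M : ℝ) (hM : 0 < M) (hdiss : ∀ y : ℝ, deriv b y ≤ -M)
    (σ x ε : ℝ) (hε : 0 < ε) (H : ℝ) (hH : H ∈ Set.Ioo (1 / 2 : ℝ) 1)
    (X Y : ℝ → ℝ) (hX : ContinuousOn X (Set.Icc 0 T)) (hY : ContinuousOn Y (Set.Icc 0 T))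
    (hXeq : ∀ t ∈ Set.Icc (0 : ℝ) T, X t = x + (∫ s in (0 : ℝ)..t, b (X s)) + σ * w t)
    (hYeq : ∀ t ∈ Set.Icc (0 : ℝ) T, Y t = x + ε + (∫ s in (0 : ℝ)..t, b (Y s)) + σ * w t)
    (φ : ℝ → ℝ) (hφ : ContDiff ℝ 1 φ) (Kφ : ℝ) (hKφ : ∀ y : ℝ, |deriv φ y| ≤ Kφ) :
    ∀ t ∈ Set.Ioc (0 : ℝ) T,
      H * (2 * H - 1) * σ ^ 2 *
        ∫ u in (0 : ℝ)..t, ∫ v in (0 : ℝ)..u,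
          |deriv φ (X u)| *
            |Real.exp (∫ r in v..u, deriv b (X r)) - (Y u - X u) / (Y v - X v)| *
              (u - v) ^ (2 * H - 2) ≤
      H * σ ^ 2 * Kb * Kφ / (2 * M ^ 2) * ε * t ^ (2 * H - 1) := by
  intro t ht
  have h0 : Y 0 - X 0 = ε := by
    have h0T : (0 : ℝ) ∈ Icc 0 T := ⟨le_rfl, hT.le⟩
    rw [hXeq 0 h0T, hYeq 0 h0T]
    simp
  have hD : ∀ s ∈ Ioo 0 T, HasDerivAt (fun s => Y s - X s) (b (Y s) - b (X s)) s :=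
    fun s hs => hasDerivAt_sub_of_integral_eq hb.continuous hX hY hXeq hYeq hs
  have hpos : ∀ s ∈ Icc 0 T, 0 < Y s - X s :=
    fun s hs => gap_pos hblip hX hY hD (h0 ▸ hε) hs
  have hKb0 : 0 ≤ Kb := (abs_nonneg _).trans (hKb 0)
  have hKφ0 : 0 ≤ Kφ := (abs_nonneg _).trans (hKφ 0)
  have hH1 : 0 < 2 * H - 1 := by linarith [hH.1]
  have hH0 : 0 < H := by linarith [hH.1]
  set C : ℝ := Kφ * (Kb * ε / (2 * M)) with hC
  have hC0 : 0 ≤ C := by positivity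
  have hinner (u : ℝ) (hu : u ∈ Ioc 0 t) :
      ∫ v in (0 : ℝ)..u, |deriv φ (X u)| *
        |Real.exp (∫ r in v..u, deriv b (X r)) - (Y u - X u) / (Y v - X v)| *
          (u - v) ^ (2 * H - 2) ≤
      C * (t ^ (2 * H - 1) / (2 * H - 1)) * Real.exp (-(M * u)) := by
    have hi : IntervalIntegrable (fun v => (u - v) ^ (2 * H - 2)) volume 0 u := by
      simpa using ((intervalIntegral.intervalIntegrable_rpow' (a := 0) (b := u)
        (by linarith : -1 < 2 * H - 2)).comp_sub_left u).symm
    have hval : ∫ v in (0 : ℝ)..u, (u - v) ^ (2 * H - 2) = u ^ (2 * H - 1) / (2 * H - 1) := by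
      rw [intervalIntegral.integral_comp_sub_left (fun v => v ^ (2 * H - 2)) u,
        integral_rpow (Or.inl (by linarith))]
      rw [show 2 * H - 2 + 1 = 2 * H - 1 by ring, sub_self, sub_zero, Real.zero_rpow hH1.ne',
        sub_zero]
    calc _ ≤ ∫ v in (0 : ℝ)..u, C * Real.exp (-(M * u)) * (u - v) ^ (2 * H - 2) := by
          refine intervalIntegral_mono_of_nonneg hu.1.le (fun v hv => ?_) (hi.const_mul _)
            (fun v hv => ?_)
          · exact mul_nonneg (by positivity) (Real.rpow_nonneg (sub_nonneg.2 hv.2) _)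
          · refine mul_le_mul_of_nonneg_right ?_ (Real.rpow_nonneg (sub_nonneg.2 hv.2) _)
            have h := abs_exp_integral_sub_ratio_le hb hKb hM hdiss hX hY hD hpos hv.1.le hv.2
              (hu.2.trans ht.2)
            rw [h0] at h
            rw [hC, mul_assoc]
            exact mul_le_mul (hKφ _) h (abs_nonneg _) hKφ0
      _ = C * (u ^ (2 * H - 1) / (2 * H - 1)) * Real.exp (-(M * u)) := by
          rw [intervalIntegral.integral_const_mul, hval]
          ring
      _ ≤ _ := by
          have := Real.rpow_le_rpow hu.1.le hu.2 hH1.le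
          gcongr
  have hexp : ∫ u in (0 : ℝ)..t, Real.exp (-(M * u)) ≤ 1 / M := by
    have h (r : ℝ) : HasDerivAt (fun r => -(1 / M) * Real.exp (-(M * r)))
        (Real.exp (-(M * r))) r := by
      refine (((hasDerivAt_id' r).const_mul M).fun_neg.exp.const_mul (-(1 / M))).congr_deriv ?_
      field_simp
    rw [intervalIntegral.integral_eq_sub_of_hasDerivAt (fun r _ => h r)
      ((by fun_prop : Continuous fun r : ℝ => Real.exp (-(M * r))).intervalIntegrable _ _)]
    have : 0 ≤ 1 / M * Real.exp (-(M * t)) := by positivity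
    simp only [mul_zero, neg_zero, Real.exp_zero]
    linarith
  have houter := intervalIntegral_mono_of_nonneg ht.1.le (fun u hu =>
    intervalIntegral.integral_nonneg hu.1.le fun v hv =>
      mul_nonneg (mul_nonneg (abs_nonneg _) (abs_nonneg _))
        (Real.rpow_nonneg (sub_nonneg.2 hv.2) _))
    ((by fun_prop : Continuous fun u : ℝ =>
      C * (t ^ (2 * H - 1) / (2 * H - 1)) * Real.exp (-(M * u))).intervalIntegrable 0 t) hinner
  rw [intervalIntegral.integral_const_mul] at houter
  have ht0 : 0 ≤ t ^ (2 * H - 1) := Real.rpow_nonneg ht.1.le _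
  have hbound := houter.trans (mul_le_mul_of_nonneg_left hexp
    (mul_nonneg hC0 (div_nonneg ht0 hH1.le)))
  refine (mul_le_mul_of_nonneg_left hbound (by positivity)).trans_eq ?_
  have hH2 : H * 2 - 1 ≠ 0 := (mul_comm H 2 ▸ hH1).ne'
  rw [hC]
  field_simp
end

section
/- Let ρ ∈ [−1,1], let (U,V) be a centered Gaussian random vector in ℝ² with Var(U) = Var(V) = 1 and Cov(U,V) = ρ, and let G : ℝ → ℝ be measurable with 𝔼[G(U)] = 0 and 𝔼[G(U)²] < ∞. Then |𝔼[G(U) G(V)]| ≤ |ρ| · 𝔼[G(U)²]. -/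
open Set Filter MeasureTheory ProbabilityTheory
open scoped ENNReal NNReal

/-- Two finite measures on `ℝ` with the same everywhere finite moment generating function agree. -/
lemma measure_ext_of_mgf_id_eq_of_integrableExpSet_eq_univ {ν ν' : Measure ℝ}
    [IsFiniteMeasure ν] [IsFiniteMeasure ν'] (hν : integrableExpSet id ν = Set.univ)
    (h : mgf id ν = mgf id ν') : ν = ν' := by
  have hzero : ν = 0 ↔ ν' = 0 := by
    have h0 := congrFun h 0
    simp only [mgf_zero', measureReal_def] at h0
    rw [ENNReal.toReal_eq_toReal_iff' (measure_ne_top _ _) (measure_ne_top _ _)] at h0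
    rw [← Measure.measure_univ_eq_zero, ← Measure.measure_univ_eq_zero, h0]
  refine Measure.ext_of_complexMGF_id_eq (funext fun z => ?_)
  exact eqOn_complexMGF_of_mgf' h hzero (by simp [hν])

/-- If `f` times every exponential is integrable, then all exponential moments are finite for the
measure with density `f.toNNReal`. -/
lemma integrableExpSet_withDensity_toNNReal {γ : Measure ℝ} {f : ℝ → ℝ} (hf : Measurable f)
    (hint : ∀ a, Integrable (fun x => f x * Real.exp (a * x)) γ) :
    integrableExpSet id (γ.withDensity fun x => ((f x).toNNReal : ℝ≥0∞)) = Set.univ := by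
  refine Set.eq_univ_of_forall fun a => ?_
  change Integrable _ _
  rw [integrable_withDensity_iff_integrable_coe_smul hf.real_toNNReal]
  refine (hint a).mono (by fun_prop) (ae_of_all _ fun x => ?_)
  simp only [id, smul_eq_mul, norm_mul, Real.coe_toNNReal', Real.norm_eq_abs]
  refine mul_le_mul_of_nonneg_right ?_ (abs_nonneg _)
  rw [abs_of_nonneg (le_max_right _ _)]
  exact max_le (le_abs_self _) (abs_nonneg _)

/-- A function is a.e. zero if its two-sided Laplace transform exists and vanishes everywhere. -/
lemma ae_eq_zero_of_forall_integral_mul_exp_eq_zero {γ : Measure ℝ} {f : ℝ → ℝ}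
    (hf : Measurable f) (hint : ∀ a, Integrable (fun x => f x * Real.exp (a * x)) γ)
    (h : ∀ a, ∫ x, f x * Real.exp (a * x) ∂γ = 0) : f =ᵐ[γ] 0 := by
  have hfi : Integrable f γ := by simpa using hint 0
  have hfin : ∫⁻ x, ((f x).toNNReal : ℝ≥0∞) ∂γ ≠ ∞ := hfi.lintegral_lt_top.ne
  have hfin' : ∫⁻ x, ((-f x).toNNReal : ℝ≥0∞) ∂γ ≠ ∞ := hfi.neg.lintegral_lt_top.ne
  have hint' : ∀ a, Integrable (fun x => -f x * Real.exp (a * x)) γ := fun a => by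
    simpa using (hint a).neg
  have : IsFiniteMeasure (γ.withDensity fun x => ((f x).toNNReal : ℝ≥0∞)) :=
    isFiniteMeasure_withDensity hfin
  have : IsFiniteMeasure (γ.withDensity fun x => ((-f x).toNNReal : ℝ≥0∞)) :=
    isFiniteMeasure_withDensity hfin'
  have hexp := integrableExpSet_withDensity_toNNReal hf hint
  have hexp' := integrableExpSet_withDensity_toNNReal hf.neg hint'
  have hae : (fun x => ((f x).toNNReal : ℝ≥0∞)) =ᵐ[γ] fun x => ((-f x).toNNReal : ℝ≥0∞) := by
    rw [← withDensity_eq_iff (by fun_prop) (by fun_prop) hfin]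
    refine measure_ext_of_mgf_id_eq_of_integrableExpSet_eq_univ hexp (funext fun a => ?_)
    have ha : a ∈ integrableExpSet id (γ.withDensity fun x => ((f x).toNNReal : ℝ≥0∞)) := by
      simp [hexp]
    have ha' : a ∈ integrableExpSet id (γ.withDensity fun x => ((-f x).toNNReal : ℝ≥0∞)) := by
      have := Set.mem_univ a
      rwa [← hexp'] at this
    change Integrable _ _ at ha ha'
    rw [integrable_withDensity_iff_integrable_coe_smul (by fun_prop)] at ha ha'
    rw [mgf, mgf, integral_withDensity_eq_integral_smul (by fun_prop),
      integral_withDensity_eq_integral_smul (by fun_prop), ← sub_eq_zero]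
    simp only [NNReal.smul_def]
    rw [← integral_sub ha ha', ← h a]
    congr with x
    simp only [id, smul_eq_mul, Real.coe_toNNReal', ← sub_mul]
    congr 1
    rcases le_total (f x) 0 with hx | hx <;> simp [hx]
  filter_upwards [hae] with x hx
  rw [ENNReal.coe_inj] at hx
  rcases le_total (f x) 0 with h0 | h0
  · rw [Real.toNNReal_of_nonpos h0, eq_comm, Real.toNNReal_eq_zero] at hx
    exact le_antisymm h0 (neg_nonpos.mp hx)
  · rw [Real.toNNReal_of_nonpos (by linarith : -f x ≤ 0), Real.toNNReal_eq_zero] at hx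
    exact le_antisymm hx h0

/-- The exponential kernel `exp (r a b)` expands as a power series in `r` with squares as
coefficients. -/
lemma hasSum_pow_mul_sq_sum_mul_pow (r : ℝ) (s : Finset ℝ) (c : ℝ → ℝ) :
    HasSum (fun q : ℕ => r ^ q * ((∑ a ∈ s, c a * a ^ q) ^ 2 / q.factorial))
      (∑ a ∈ s, ∑ b ∈ s, c a * c b * Real.exp (r * a * b)) := by
  have h : HasSum (fun q : ℕ => ∑ a ∈ s, ∑ b ∈ s, c a * c b * ((r * a * b) ^ q / q.factorial))
      (∑ a ∈ s, ∑ b ∈ s, c a * c b * Real.exp (r * a * b)) := by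
    refine hasSum_sum fun a _ => hasSum_sum fun b _ => HasSum.mul_left _ ?_
    rw [Real.exp_eq_exp_ℝ]
    exact NormedSpace.expSeries_div_hasSum_exp _
  convert h using 2 with q
  rw [sq, Finset.sum_mul_sum, Finset.sum_div, Finset.mul_sum]
  refine Finset.sum_congr rfl fun a _ => ?_
  rw [Finset.sum_div, Finset.mul_sum]
  refine Finset.sum_congr rfl fun b _ => ?_
  rw [mul_pow, mul_pow]
  ring

/-- The covariance bound for the kernel `exp (ρ a b)`. -/
lemma abs_sum_mul_exp_sub_le {ρ : ℝ} (hρ : |ρ| ≤ 1) (s : Finset ℝ) (c : ℝ → ℝ) :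
    |(∑ a ∈ s, ∑ b ∈ s, c a * c b * Real.exp (ρ * a * b)) - (∑ a ∈ s, c a) ^ 2| ≤
      |ρ| * ((∑ a ∈ s, ∑ b ∈ s, c a * c b * Real.exp (a * b)) - (∑ a ∈ s, c a) ^ 2) := by
  have tail (r : ℝ) : HasSum
      (fun q : ℕ => r ^ (q + 1) * ((∑ a ∈ s, c a * a ^ (q + 1)) ^ 2 / (q + 1).factorial))
      ((∑ a ∈ s, ∑ b ∈ s, c a * c b * Real.exp (r * a * b)) - (∑ a ∈ s, c a) ^ 2) := by
    have := (hasSum_nat_add_iff' 1).mpr (hasSum_pow_mul_sq_sum_mul_pow r s c)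
    simpa using this
  have h1 := (tail 1).mul_left |ρ|
  simp only [one_mul, one_pow] at h1
  rw [← (tail ρ).tsum_eq, ← h1.tsum_eq, ← Real.norm_eq_abs]
  refine tsum_of_norm_bounded h1.summable.hasSum fun q => ?_
  rw [norm_mul, norm_pow, Real.norm_eq_abs, Real.norm_of_nonneg (by positivity)]
  gcongr
  exact pow_le_of_le_one (abs_nonneg _) hρ (Nat.succ_ne_zero q)

/-- Square integrability of exponentials under a Gaussian measure. -/
lemma memLp_exp_mul_gaussianReal (m : ℝ) (v : ℝ≥0) (a : ℝ) :
    MemLp (fun x => Real.exp (a * x)) 2 (gaussianReal m v) := by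
  rw [memLp_two_iff_integrable_sq (by fun_prop)]
  refine (integrable_exp_mul_gaussianReal (2 * a)).congr (ae_of_all _ fun x => ?_)
  simp only [sq, ← Real.exp_add]
  ring_nf

/-- The exponential function `x ↦ exp (a x)` in `L²` of the standard Gaussian measure. -/
noncomputable def expLp (a : ℝ) : Lp ℝ 2 (gaussianReal 0 1) :=
  (memLp_exp_mul_gaussianReal 0 1 a).toLp

/-- Exponentials span a dense subspace of `L²` of the standard Gaussian measure. -/
lemma topologicalClosure_span_range_expLp :
    (Submodule.span ℝ (Set.range expLp)).topologicalClosure = ⊤ := by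
  rw [Submodule.topologicalClosure_eq_top_iff, Submodule.eq_bot_iff]
  intro f hf
  rw [Lp.eq_zero_iff_ae_eq_zero]
  have hfm : MemLp f 2 (gaussianReal 0 1) := Lp.memLp f
  refine ae_eq_zero_of_forall_integral_mul_exp_eq_zero (Lp.stronglyMeasurable f).measurable
    (fun a => hfm.integrable_mul (memLp_exp_mul_gaussianReal 0 1 a)) fun a => ?_
  have h := hf (expLp a) (Submodule.subset_span ⟨a, rfl⟩)
  rw [L2.inner_def] at h
  refine Eq.trans (integral_congr_ae ?_) h
  filter_upwards [(memLp_exp_mul_gaussianReal 0 1 a).coeFn_toLp] with x hx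
  simp [expLp, hx]

section GaussianPair

variable {Ω : Type*} [MeasurableSpace Ω] {μ : Measure Ω} {U V : Ω → ℝ}

/-- The `L²` inner product of `g(U)` and `h(V)` as an integral. -/
lemma inner_compMeasurePreserving_toLp {γ : Measure ℝ} (hU : MeasurePreserving U μ γ)
    (hV : MeasurePreserving V μ γ) {g h : ℝ → ℝ} (hg : MemLp g 2 γ) (hh : MemLp h 2 γ) :
    inner ℝ (Lp.compMeasurePreserving U hU hg.toLp) (Lp.compMeasurePreserving V hV hh.toLp) =
      ∫ ω, g (U ω) * h (V ω) ∂μ := by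
  rw [Lp.toLp_compMeasurePreserving, Lp.toLp_compMeasurePreserving, L2.inner_def]
  refine integral_congr_ae ?_
  filter_upwards [(hg.comp_measurePreserving hU).coeFn_toLp,
    (hh.comp_measurePreserving hV).coeFn_toLp] with ω h1 h2
  rw [h1, h2]
  simp [mul_comm]

/-- The joint exponential moments of a standard Gaussian pair with correlation `ρ`. -/
lemma integral_exp_mul_exp_of_map_eq_gaussianReal {ρ : ℝ} (hρ : ρ ∈ Set.Icc (-1 : ℝ) 1)
    (hgauss : ∀ a b : ℝ, Measure.map (fun ω => a * U ω + b * V ω) μ =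
      gaussianReal 0 (Real.toNNReal (a ^ 2 + 2 * a * b * ρ + b ^ 2))) (a b : ℝ) :
    ∫ ω, Real.exp (a * U ω) * Real.exp (b * V ω) ∂μ =
      Real.exp (a ^ 2 / 2) * Real.exp (b ^ 2 / 2) * Real.exp (ρ * a * b) := by
  have h := mgf_gaussianReal (hgauss a b) 1
  have hnn : 0 ≤ a ^ 2 + 2 * a * b * ρ + b ^ 2 := by
    have hρ2 : 0 ≤ 1 - ρ ^ 2 := by nlinarith [hρ.1, hρ.2]
    nlinarith [sq_nonneg (a * ρ + b), mul_nonneg hρ2 (sq_nonneg a)]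
  rw [Real.coe_toNNReal _ hnn] at h
  simp only [mgf, one_mul, Real.exp_add] at h
  rw [h, ← Real.exp_add, ← Real.exp_add, ← Real.exp_add]
  ring_nf

/-- The covariance bound in `L²` of the standard Gaussian measure, without centering. -/
lemma abs_inner_compMeasurePreserving_sub_le {ρ : ℝ} (hρ : ρ ∈ Set.Icc (-1 : ℝ) 1)
    (hU : MeasurePreserving U μ (gaussianReal 0 1)) (hV : MeasurePreserving V μ (gaussianReal 0 1))
    (hgauss : ∀ a b : ℝ, Measure.map (fun ω => a * U ω + b * V ω) μ =
      gaussianReal 0 (Real.toNNReal (a ^ 2 + 2 * a * b * ρ + b ^ 2)))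
    (g : Lp ℝ 2 (gaussianReal 0 1)) :
    |inner ℝ (Lp.compMeasurePreservingₗᵢ ℝ U hU g) (Lp.compMeasurePreservingₗᵢ ℝ V hV g) -
        inner ℝ g (expLp 0) ^ 2| ≤ |ρ| * (inner ℝ g g - inner ℝ g (expLp 0) ^ 2) := by
  have hmem : g ∈ closure (Submodule.span ℝ (Set.range expLp) :
      Set (Lp ℝ 2 (gaussianReal 0 1))) := by
    rw [← Submodule.topologicalClosure_coe, topologicalClosure_span_range_expLp]
    trivial
  refine closure_minimal (t := {g | |inner ℝ (Lp.compMeasurePreservingₗᵢ ℝ U hU g)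
    (Lp.compMeasurePreservingₗᵢ ℝ V hV g) - inner ℝ g (expLp 0) ^ 2| ≤
      |ρ| * (inner ℝ g g - inner ℝ g (expLp 0) ^ 2)}) ?_ ?_ hmem
  · intro g hg
    obtain ⟨c, rfl⟩ := Finsupp.mem_span_range_iff_exists_finsupp.mp hg
    have hUV (a b : ℝ) : inner ℝ (Lp.compMeasurePreservingₗᵢ ℝ U hU (expLp a))
        (Lp.compMeasurePreservingₗᵢ ℝ V hV (expLp b)) =
        Real.exp (a ^ 2 / 2) * Real.exp (b ^ 2 / 2) * Real.exp (ρ * a * b) :=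
      (inner_compMeasurePreserving_toLp hU hV _ _).trans
        (integral_exp_mul_exp_of_map_eq_gaussianReal hρ hgauss a b)
    have hid (a b : ℝ) : inner ℝ (expLp a) (expLp b) =
        Real.exp (a ^ 2 / 2) * Real.exp (b ^ 2 / 2) * Real.exp (a * b) := by
      have h := mgf_gaussianReal (Measure.map_id (μ := gaussianReal 0 1)) (a + b)
      have hint := inner_compMeasurePreserving_toLp (.id _) (.id _)
        (memLp_exp_mul_gaussianReal 0 1 a) (memLp_exp_mul_gaussianReal 0 1 b)
      rw [Lp.compMeasurePreserving_id] at hint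
      refine hint.trans ?_
      simp only [id]
      simp only [mgf, id, add_mul, Real.exp_add] at h
      rw [h, ← Real.exp_add, ← Real.exp_add, ← Real.exp_add, NNReal.coe_one]
      ring_nf
    have key := abs_sum_mul_exp_sub_le (abs_le.mpr hρ) c.support
      fun a => c a * Real.exp (a ^ 2 / 2)
    simp only [Set.mem_ofPred_eq, Finsupp.sum, map_sum, map_smul, sum_inner, inner_sum,
      real_inner_smul_left, real_inner_smul_right, hUV, hid]
    convert key using 4 <;>
      simp [mul_assoc, mul_left_comm, mul_comm]
  · exact isClosed_le (by fun_prop) (by fun_prop)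

end GaussianPair


open Set Filter MeasureTheory ProbabilityTheory

/-- Covariance bound for functionals of a bivariate Gaussian pair: if `(U,V)` is a centered
Gaussian vector with unit variances and covariance `ρ`, and `G` is centered and square
integrable with respect to the standard Gaussian law, then `|𝔼[G(U)G(V)]| ≤ |ρ| 𝔼[G(U)²]`. -/
theorem gaussian_covariance_bound
    {Ω : Type*} [MeasurableSpace Ω] (μ : Measure Ω) [IsProbabilityMeasure μ]
    (U V : Ω → ℝ) (hU : Measurable U) (hV : Measurable V)
    (ρ : ℝ) (hρ : ρ ∈ Set.Icc (-1 : ℝ) 1)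
    (hgauss : ∀ a b : ℝ,
      Measure.map (fun ω => a * U ω + b * V ω) μ =
        gaussianReal 0 (Real.toNNReal (a ^ 2 + 2 * a * b * ρ + b ^ 2)))
    (G : ℝ → ℝ) (hG : Measurable G)
    (hGmean : (∫ ω, G (U ω) ∂μ) = 0)
    (hGsq : Integrable (fun ω => (G (U ω)) ^ 2) μ) :
    |∫ ω, G (U ω) * G (V ω) ∂μ| ≤ |ρ| * ∫ ω, (G (U ω)) ^ 2 ∂μ := by
  have hUm : MeasurePreserving U μ (gaussianReal 0 1) := ⟨hU, by simpa using hgauss 1 0⟩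
  have hVm : MeasurePreserving V μ (gaussianReal 0 1) := ⟨hV, by simpa using hgauss 0 1⟩
  have hG2 : MemLp G 2 (gaussianReal 0 1) := by
    rw [memLp_two_iff_integrable_sq hG.aestronglyMeasurable]
    exact (hUm.integrable_comp (by fun_prop)).mp hGsq
  have hmean : inner ℝ hG2.toLp (expLp 0) = 0 := by
    rw [← LinearIsometry.inner_map_map (Lp.compMeasurePreservingₗᵢ ℝ U hUm)]
    refine (inner_compMeasurePreserving_toLp hUm hUm hG2 _).trans ?_
    simpa using hGmean
  have hself : inner ℝ hG2.toLp hG2.toLp = ∫ ω, (G (U ω)) ^ 2 ∂μ := by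
    rw [← LinearIsometry.inner_map_map (Lp.compMeasurePreservingₗᵢ ℝ U hUm)]
    refine (inner_compMeasurePreserving_toLp hUm hUm hG2 hG2).trans ?_
    simp only [sq]
  have h := abs_inner_compMeasurePreserving_sub_le hρ hUm hVm hgauss hG2.toLp
  rw [hmean, hself] at h
  simp only [ne_eq, OfNat.ofNat_ne_zero, not_false_eq_true, zero_pow, sub_zero] at h
  rwa [← inner_compMeasurePreserving_toLp hUm hVm hG2 hG2]
end

section
/- Let T > 0, let ρ : ℝ → [−1,1] be measurable, and let (Y(s))_{s ∈ [0,T]} be a measurable real-valued stochastic process such that for all u, v ∈ [0,T], the pair (Y(u), Y(v)) is a centered Gaussian vector with Var(Y(u)) = Var(Y(v)) = 1 and Cov(Y(u), Y(v)) = ρ(v − u). Let G : ℝ → ℝ be measurable with 𝔼[G(U)] = 0 and 𝔼[G(U)²] < ∞ for U standard normal. Then 𝔼[(∫₀ᵀ G(Y(s)) ds)²] ≤ 𝔼[G(U)²] · ∫₀ᵀ ∫₀ᵀ |ρ(v − u)| du dv. -/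
open Set Filter MeasureTheory ProbabilityTheory

theorem memLp_two_exp_mul_gaussianReal (a : ℝ) :
    MemLp (fun x ↦ Real.exp (a * x)) 2 (gaussianReal 0 1) := by
  rw [memLp_two_iff_integrable_sq (by fun_prop)]
  convert integrable_exp_mul_gaussianReal (μ := 0) (v := 1) (2 * a) using 2 with x
  rw [← Real.exp_nat_mul]
  push_cast
  ring_nf

/-- A square integrable function is determined by its integrals against real exponentials. -/
theorem ae_eq_zero_of_forall_integral_exp_mul_eq_zero {G : ℝ → ℝ}
    (hG : MemLp G 2 (gaussianReal 0 1))
    (h : ∀ a : ℝ, ∫ x, Real.exp (a * x) * G x ∂gaussianReal 0 1 = 0) :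
    G =ᵐ[gaussianReal 0 1] 0 := by
  set γ := gaussianReal 0 1
  have hGint : Integrable G γ := hG.integrable (by norm_num)
  have hexpG (a : ℝ) : Integrable (fun x ↦ Real.exp (a * x) * G x) γ :=
    (memLp_two_exp_mul_gaussianReal a).integrable_mul hG
  let ν : (ℝ → ℝ) → Measure ℝ := fun F ↦ γ.withDensity fun x ↦ ENNReal.ofReal (F x)
  have hfin : ∀ F : ℝ → ℝ, Integrable F γ → IsFiniteMeasure (ν F) := fun F hF ↦
    isFiniteMeasure_withDensity_ofReal hF.2
  have := hfin G hGint
  have := hfin (fun x ↦ -G x) hGint.neg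
  have hm : AEMeasurable (fun x ↦ ENNReal.ofReal (G x)) γ := hGint.1.aemeasurable.ennreal_ofReal
  have hm' : AEMeasurable (fun x ↦ ENNReal.ofReal (-G x)) γ :=
    hGint.1.aemeasurable.neg.ennreal_ofReal
  have hmax (a : ℝ) : Integrable (fun x ↦ max (G x) 0 * Real.exp (a * x)) γ := by
    refine (hexpG a).pos_part.congr (.of_forall fun x ↦ ?_)
    dsimp only
    rw [max_mul_of_nonneg _ _ (Real.exp_pos _).le, zero_mul, mul_comm]
  have hmax' (a : ℝ) : Integrable (fun x ↦ max (-G x) 0 * Real.exp (a * x)) γ := by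
    refine (hexpG a).neg_part.congr (.of_forall fun x ↦ ?_)
    dsimp only
    rw [max_mul_of_nonneg _ _ (Real.exp_pos _).le, zero_mul, neg_mul, mul_comm]
  have hmgf : mgf id (ν G) = mgf id (ν fun x ↦ -G x) := by
    ext a
    simp only [mgf, ν, id]
    rw [integral_withDensity_eq_integral_toReal_smul₀ hm (by simp),
      integral_withDensity_eq_integral_toReal_smul₀ hm' (by simp), ← sub_eq_zero]
    simp only [ENNReal.toReal_ofReal', smul_eq_mul]
    rw [← integral_sub (hmax a) (hmax' a)]
    refine Eq.trans ?_ (h a)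
    refine integral_congr_ae (.of_forall fun x ↦ ?_)
    have hx : max (G x) 0 - max (-G x) 0 = G x := by
      rcases le_total (G x) 0 with hx | hx <;> simp [hx]
    dsimp only
    rw [← sub_mul, hx, mul_comm]
  have hset : integrableExpSet id (ν G) = univ := by
    refine eq_univ_of_forall fun a ↦ ?_
    simp only [integrableExpSet, mem_ofPred_eq, ν, id]
    rw [integrable_withDensity_iff_integrable_smul₀' hm (by simp)]
    simpa only [ENNReal.toReal_ofReal', smul_eq_mul] using hmax a
  have hzero : ν G = 0 ↔ (ν fun x ↦ -G x) = 0 := by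
    have h0 := congrFun hmgf 0
    rw [mgf_zero', mgf_zero'] at h0
    rw [← Measure.measure_univ_eq_zero, ← measureReal_eq_zero_iff, h0, measureReal_eq_zero_iff,
      Measure.measure_univ_eq_zero]
  have heq : ν G = ν fun x ↦ -G x := by
    refine Measure.ext_of_complexMGF_id_eq (funext fun z ↦ ?_)
    exact eqOn_complexMGF_of_mgf' hmgf hzero (by simp [hset])
  have hae := (withDensity_eq_iff hm hm' (hGint.lintegral_lt_top.ne)).1 heq
  filter_upwards [hae] with x hx
  have h1 := congrArg ENNReal.toReal hx
  simp only [ENNReal.toReal_ofReal'] at h1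
  rcases le_total (G x) 0 with hx | hx <;> simp [hx] at h1 <;> simp [h1]

/-- Gebelein inequality for finite combinations of exponentials, in coordinates. -/
theorem abs_sum_exp_mul_sub_le (s : Finset ℝ) (c : ℝ → ℝ) {r : ℝ} (hr : |r| ≤ 1) :
    |∑ a ∈ s, ∑ b ∈ s, c a * c b * Real.exp (r * a * b) - (∑ a ∈ s, c a) ^ 2| ≤
      |r| * (∑ a ∈ s, ∑ b ∈ s, c a * c b * Real.exp (a * b) - (∑ a ∈ s, c a) ^ 2) := by
  have hsum (t : ℝ) : HasSum
      (fun n : ℕ ↦ t ^ (n + 1) * ((∑ a ∈ s, c a * a ^ (n + 1)) ^ 2 / (n + 1).factorial))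
      (∑ a ∈ s, ∑ b ∈ s, c a * c b * Real.exp (t * a * b) - (∑ a ∈ s, c a) ^ 2) := by
    have h : HasSum (fun n : ℕ ↦ ∑ a ∈ s, ∑ b ∈ s, c a * c b * ((t * a * b) ^ n / n.factorial))
        (∑ a ∈ s, ∑ b ∈ s, c a * c b * Real.exp (t * a * b)) := by
      refine hasSum_sum fun a _ ↦ hasSum_sum fun b _ ↦ HasSum.mul_left _ ?_
      rw [Real.exp_eq_exp_ℝ]
      exact NormedSpace.expSeries_div_hasSum_exp _
    have h' : HasSum (fun n : ℕ ↦ t ^ n * ((∑ a ∈ s, c a * a ^ n) ^ 2 / n.factorial))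
        (∑ a ∈ s, ∑ b ∈ s, c a * c b * Real.exp (t * a * b)) := by
      convert h using 2 with n
      rw [sq, Finset.sum_mul_sum, Finset.sum_div, Finset.mul_sum]
      refine Finset.sum_congr rfl fun a _ ↦ ?_
      rw [Finset.sum_div, Finset.mul_sum]
      refine Finset.sum_congr rfl fun b _ ↦ ?_
      rw [mul_pow, mul_pow]
      ring
    simpa using (hasSum_nat_add_iff' 1).2 h'
  have h1 := hsum 1
  simp only [one_pow, one_mul] at h1
  have habs (n : ℕ) :
      |r ^ (n + 1) * ((∑ a ∈ s, c a * a ^ (n + 1)) ^ 2 / (n + 1).factorial)| ≤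
        |r| * ((∑ a ∈ s, c a * a ^ (n + 1)) ^ 2 / (n + 1).factorial) := by
    have hq : 0 ≤ (∑ a ∈ s, c a * a ^ (n + 1)) ^ 2 / ((n + 1).factorial : ℝ) := by positivity
    rw [abs_mul, abs_of_nonneg hq, abs_pow]
    gcongr
    exact pow_le_of_le_one (abs_nonneg r) hr n.succ_ne_zero
  rw [abs_le]
  exact ⟨hasSum_le (fun n ↦ (abs_le.1 (habs n)).1) (h1.mul_left |r|).neg (hsum r),
    hasSum_le (fun n ↦ (abs_le.1 (habs n)).2) (hsum r) (h1.mul_left |r|)⟩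

/-- Gebelein inequality: a square integrable function of two standard Gaussian variables with
correlation `r` has covariance at most `|r|` times its variance. -/
theorem abs_integral_mul_sub_sq_le_of_gaussian {Ω : Type*} [MeasurableSpace Ω] {μ : Measure Ω}
    {X Z : Ω → ℝ} (hX : Measurable X) (hZ : Measurable Z) {r : ℝ} (hr : |r| ≤ 1)
    (hXZ : ∀ a b : ℝ, Measure.map (fun ω ↦ a * X ω + b * Z ω) μ =
      gaussianReal 0 (Real.toNNReal (a ^ 2 + 2 * a * b * r + b ^ 2)))
    {G : ℝ → ℝ} (hG : MemLp G 2 (gaussianReal 0 1)) :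
    |∫ ω, G (X ω) * G (Z ω) ∂μ - (∫ y, G y ∂gaussianReal 0 1) ^ 2| ≤
      |r| * (∫ y, G y ^ 2 ∂gaussianReal 0 1 - (∫ y, G y ∂gaussianReal 0 1) ^ 2) := by
  set γ := gaussianReal 0 1
  have hpX : MeasurePreserving X μ γ := ⟨hX, by simpa using hXZ 1 0⟩
  have hpZ : MeasurePreserving Z μ γ := ⟨hZ, by simpa using hXZ 0 1⟩
  let A := Lp.compMeasurePreservingₗᵢ ℝ (E := ℝ) (p := 2) X hpX
  let B := Lp.compMeasurePreservingₗᵢ ℝ (E := ℝ) (p := 2) Z hpZ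
  have hinner {F H : ℝ → ℝ} (hF : MemLp F 2 γ) (hH : MemLp H 2 γ) :
      inner ℝ (hF.toLp F) (hH.toLp H) = ∫ y, F y * H y ∂γ := by
    rw [L2.inner_def]
    refine integral_congr_ae ?_
    filter_upwards [hF.coeFn_toLp, hH.coeFn_toLp] with y h1 h2
    rw [h1, h2, real_inner_eq_re_inner, RCLike.inner_apply]
    simp [mul_comm]
  have hinnerAB {F H : ℝ → ℝ} (hF : MemLp F 2 γ) (hH : MemLp H 2 γ) :
      inner ℝ (A (hF.toLp F)) (B (hH.toLp H)) = ∫ ω, F (X ω) * H (Z ω) ∂μ := by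
    change inner ℝ ((hF.comp_measurePreserving hpX).toLp _)
      ((hH.comp_measurePreserving hpZ).toLp _) = _
    rw [L2.inner_def]
    refine integral_congr_ae ?_
    filter_upwards [(hF.comp_measurePreserving hpX).coeFn_toLp,
      (hH.comp_measurePreserving hpZ).coeFn_toLp] with y h1 h2
    rw [h1, h2, real_inner_eq_re_inner, RCLike.inner_apply]
    simp [mul_comm]
  have hone : MemLp (fun _ : ℝ ↦ (1 : ℝ)) 2 γ := memLp_const 1
  have he (a : ℝ) : MemLp (fun x ↦ Real.exp (-(a ^ 2 / 2)) * Real.exp (a * x)) 2 γ :=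
    (memLp_two_exp_mul_gaussianReal a).const_mul _
  let e : ℝ → Lp ℝ 2 γ := fun a ↦ (he a).toLp _
  have hmgf (t : ℝ) : ∫ x, Real.exp (t * x) ∂γ = Real.exp (t ^ 2 / 2) := by
    simpa [mgf] using congrFun (mgf_fun_id_gaussianReal (μ := 0) (v := 1)) t
  have he1 (a : ℝ) : inner ℝ (hone.toLp _) (e a) = 1 := by
    rw [hinner]
    simp only [one_mul]
    rw [integral_const_mul, hmgf, ← Real.exp_add]
    simp
  have hee (a b : ℝ) : inner ℝ (e a) (e b) = Real.exp (a * b) := by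
    rw [hinner]
    have hrw (x : ℝ) : Real.exp (-(a ^ 2 / 2)) * Real.exp (a * x) *
        (Real.exp (-(b ^ 2 / 2)) * Real.exp (b * x)) =
        Real.exp (-(a ^ 2 / 2) - b ^ 2 / 2) * Real.exp ((a + b) * x) := by
      simp only [← Real.exp_add]
      ring_nf
    simp only [hrw]
    rw [integral_const_mul, hmgf, ← Real.exp_add]
    ring_nf
  have heAB (a b : ℝ) : inner ℝ (A (e a)) (B (e b)) = Real.exp (r * a * b) := by
    rw [hinnerAB]
    have hrw (ω : Ω) : Real.exp (-(a ^ 2 / 2)) * Real.exp (a * X ω) *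
        (Real.exp (-(b ^ 2 / 2)) * Real.exp (b * Z ω)) =
        Real.exp (-(a ^ 2 / 2) - b ^ 2 / 2) * Real.exp (1 * (a * X ω + b * Z ω)) := by
      simp only [← Real.exp_add]
      ring_nf
    have hnn : 0 ≤ a ^ 2 + 2 * a * b * r + b ^ 2 := by
      have := abs_le.1 hr
      nlinarith [sq_nonneg (a + r * b), mul_nonneg (sq_nonneg b)
        (mul_nonneg (sub_nonneg.2 this.2) (neg_le_iff_add_nonneg.1 this.1))]
    have hm := mgf_gaussianReal (hXZ a b) 1
    rw [Real.coe_toNNReal _ hnn] at hm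
    simp only [mgf] at hm
    simp only [hrw]
    rw [integral_const_mul, hm, ← Real.exp_add]
    ring_nf
  let S := Submodule.span ℝ (range e)
  have hdense : S.topologicalClosure = ⊤ := by
    rw [Submodule.topologicalClosure_eq_top_iff, Submodule.eq_bot_iff]
    intro f hf
    refine (Lp.eq_zero_iff_ae_eq_zero).2
      (ae_eq_zero_of_forall_integral_exp_mul_eq_zero (Lp.memLp f) fun a ↦ ?_)
    have h0 : inner ℝ (e a) f = 0 := hf _ (Submodule.subset_span (mem_range_self a))
    rw [← Lp.toLp_coeFn f (Lp.memLp f), hinner] at h0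
    simp only [mul_assoc] at h0
    rw [integral_const_mul] at h0
    exact (mul_eq_zero.1 h0).resolve_left (Real.exp_ne_zero _)
  let P : Lp ℝ 2 γ → Prop := fun f ↦
    |inner ℝ (A f) (B f) - inner ℝ (hone.toLp _) f ^ 2| ≤
      |r| * (inner ℝ f f - inner ℝ (hone.toLp _) f ^ 2)
  have hclosed : IsClosed {f | P f} := isClosed_le (by fun_prop) (by fun_prop)
  have hS : (S : Set (Lp ℝ 2 γ)) ⊆ {f | P f} := by
    intro f hf
    obtain ⟨c, rfl⟩ := Finsupp.mem_span_range_iff_exists_finsupp.1 hf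
    have := abs_sum_exp_mul_sub_le c.support c hr
    simp only [P, mem_ofPred_eq, Finsupp.sum, map_sum, map_smul, sum_inner, inner_sum,
      real_inner_smul_left, real_inner_smul_right, heAB, hee, he1, mul_one]
    simpa only [mul_assoc, mul_left_comm, mul_comm] using this
  have hall : P (hG.toLp G) := by
    have hmem : hG.toLp G ∈ S.topologicalClosure := hdense ▸ Submodule.mem_top
    exact closure_minimal hS hclosed hmem
  simp only [P, hinnerAB, hinner, one_mul, ← sq] at hall
  exact hall

/-- Second-moment bound for additive functionals of a normalized stationary Gaussian process:
if each pair `(Y(u), Y(v))` is centered Gaussian with unit variances and covariance `ρ(v-u)`,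
and `G` is centered and square integrable with respect to the standard Gaussian law, then
`𝔼[(∫₀ᵀ G(Y(s)) ds)²] ≤ 𝔼[G(U)²] ∫₀ᵀ∫₀ᵀ |ρ(v-u)| du dv`. -/
theorem additive_functional_second_moment_bound
    {Ω : Type*} [MeasurableSpace Ω] (μ : Measure Ω) [IsProbabilityMeasure μ]
    (T : ℝ) (hT : 0 < T) (ρ : ℝ → ℝ) (hρmeas : Measurable ρ)
    (hρbdd : ∀ s : ℝ, ρ s ∈ Set.Icc (-1 : ℝ) 1)
    (Y : ℝ → Ω → ℝ) (hYmeas : Measurable (fun p : ℝ × Ω => Y p.1 p.2))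
    (hgauss : ∀ u ∈ Set.Icc (0 : ℝ) T, ∀ v ∈ Set.Icc (0 : ℝ) T, ∀ a b : ℝ,
      Measure.map (fun ω => a * Y u ω + b * Y v ω) μ =
        gaussianReal 0 (Real.toNNReal (a ^ 2 + 2 * a * b * ρ (v - u) + b ^ 2)))
    (G : ℝ → ℝ) (hG : Measurable G)
    (hGmean : (∫ y, G y ∂gaussianReal 0 1) = 0)
    (hGsq : Integrable (fun y => (G y) ^ 2) (gaussianReal 0 1)) :
    (∫ ω, (∫ s in (0 : ℝ)..T, G (Y s ω)) ^ 2 ∂μ) ≤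
      (∫ y, (G y) ^ 2 ∂gaussianReal 0 1) *
        ∫ u in (0 : ℝ)..T, ∫ v in (0 : ℝ)..T, |ρ (v - u)| := by
  set γ := gaussianReal 0 1
  set C := ∫ y, G y ^ 2 ∂γ
  have hGL : MemLp G 2 γ := (memLp_two_iff_integrable_sq hG.aestronglyMeasurable).2 hGsq
  have hY (u : ℝ) : Measurable (Y u) := hYmeas.comp measurable_prodMk_left
  let lam := (volume : Measure ℝ).restrict (Ioc 0 T)
  have hlam : ∀ᵐ p ∂lam.prod lam, p.1 ∈ Icc 0 T ∧ p.2 ∈ Icc 0 T := by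
    rw [Measure.prod_restrict]
    filter_upwards [ae_restrict_mem (measurableSet_Ioc.prod measurableSet_Ioc)] with p hp
    exact ⟨Ioc_subset_Icc_self hp.1, Ioc_subset_Icc_self hp.2⟩
  have hpres {u : ℝ} (hu : u ∈ Icc 0 T) : MeasurePreserving (Y u) μ γ :=
    ⟨hY u, by simpa using hgauss u hu u hu 1 0⟩
  have hsq {u : ℝ} (hu : u ∈ Icc 0 T) : ∫ ω, G (Y u ω) ^ 2 ∂μ = C := by
    rw [← integral_map (f := fun y ↦ G y ^ 2) (hY u).aemeasurable
      (hG.pow_const 2).aestronglyMeasurable, (hpres hu).map_eq]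
  have hL {u : ℝ} (hu : u ∈ Icc 0 T) : MemLp (fun ω ↦ G (Y u ω)) 2 μ :=
    hGL.comp_measurePreserving (hpres hu)
  have hcov {u v : ℝ} (hu : u ∈ Icc 0 T) (hv : v ∈ Icc 0 T) :
      ∫ ω, G (Y u ω) * G (Y v ω) ∂μ ≤ C * |ρ (v - u)| := by
    have h := abs_integral_mul_sub_sq_le_of_gaussian (hY u) (hY v)
      (abs_le.2 (hρbdd (v - u))) (hgauss u hu v hv) hGL
    rw [hGmean] at h
    simp only [ne_eq, OfNat.ofNat_ne_zero, not_false_eq_true, zero_pow, sub_zero] at h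
    rw [mul_comm]
    exact (le_abs_self _).trans h
  let F : (ℝ × ℝ) → Ω → ℝ := fun p ω ↦ G (Y p.1 ω) * G (Y p.2 ω)
  have hFmeas : Measurable (Function.uncurry F) :=
    (hG.comp (hYmeas.comp (by fun_prop : Measurable fun q : (ℝ × ℝ) × Ω ↦ (q.1.1, q.2)))).mul
      (hG.comp (hYmeas.comp (by fun_prop : Measurable fun q : (ℝ × ℝ) × Ω ↦ (q.1.2, q.2))))
  have hFint : Integrable (Function.uncurry F) ((lam.prod lam).prod μ) := by
    refine (integrable_prod_iff hFmeas.aestronglyMeasurable).2 ⟨?_, ?_⟩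
    · filter_upwards [hlam] with p hp
      exact (hL hp.1).integrable_mul (hL hp.2)
    · refine Integrable.of_bound
        hFmeas.norm.stronglyMeasurable.integral_prod_right.aestronglyMeasurable C ?_
      filter_upwards [hlam] with p hp
      rw [Real.norm_of_nonneg (integral_nonneg fun _ ↦ norm_nonneg _)]
      have hle : ∫ ω, ‖F p ω‖ ∂μ ≤ ∫ ω, (G (Y p.1 ω) ^ 2 + G (Y p.2 ω) ^ 2) / 2 ∂μ := by
        refine integral_mono ((hL hp.1).integrable_mul (hL hp.2)).norm
          (((hL hp.1).integrable_sq.add (hL hp.2).integrable_sq).div_const 2) fun ω ↦ ?_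
        simp only [F, Real.norm_eq_abs]
        rw [abs_le]
        constructor <;>
          nlinarith [sq_nonneg (G (Y p.1 ω) + G (Y p.2 ω)), sq_nonneg (G (Y p.1 ω) - G (Y p.2 ω))]
      rw [integral_div, integral_add (hL hp.1).integrable_sq (hL hp.2).integrable_sq,
        hsq hp.1, hsq hp.2, add_self_div_two] at hle
      exact hle
  have hρint : Integrable (fun p : ℝ × ℝ ↦ |ρ (p.2 - p.1)|) (lam.prod lam) := by
    refine Integrable.of_bound
      (hρmeas.comp (measurable_snd.sub measurable_fst)).abs.aestronglyMeasurable 1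
      (.of_forall fun p ↦ ?_)
    rw [Real.norm_eq_abs, abs_abs]
    exact abs_le.2 (hρbdd _)
  simp only [intervalIntegral.integral_of_le hT.le]
  calc ∫ ω, (∫ s in Ioc 0 T, G (Y s ω)) ^ 2 ∂μ
      = ∫ ω, ∫ p, F p ω ∂lam.prod lam ∂μ := by
        refine integral_congr_ae (.of_forall fun ω ↦ ?_)
        simp only [F, sq]
        exact (integral_prod_mul (μ := lam) (ν := lam) (fun s ↦ G (Y s ω))
          (fun s ↦ G (Y s ω))).symm
    _ = ∫ p, ∫ ω, F p ω ∂μ ∂lam.prod lam := (integral_integral_swap hFint).symm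
    _ ≤ ∫ p, C * |ρ (p.2 - p.1)| ∂lam.prod lam := by
        refine integral_mono_ae hFint.integral_prod_left (hρint.const_mul C) ?_
        filter_upwards [hlam] with p hp using hcov hp.1 hp.2
    _ = C * ∫ u in Ioc 0 T, ∫ v in Ioc 0 T, |ρ (v - u)| := by
        rw [integral_const_mul, integral_prod _ hρint]
end

section
/- Let K : ℝ → ℝ₊ be continuously differentiable with supp(K) = [−1,1] and ∫ K(y) dy = 1, let ν be the standard normal density, let σ₀ > 0 and x > 0. Then for every h ∈ (0, x), ∫_ℝ (1/h) K((σ₀ y − x)/h) ν(y) y dy > 0. Symmetrically, for x < 0 and h ∈ (0, −x), this integral is strictly negative. In particular, setting G_{h,x}(y) := (1/h)K((σ₀ y − x)/h) − ∫ (1/h)K((σ₀ z − x)/h) ν(z) dz, which satisfies 𝔼[G_{h,x}(U)] = 0 for U standard normal, the first Hermite coefficient J(1) = 𝔼[G_{h,x}(U) H_1(U)] is nonzero, so the Hermite rank of G_{h,x} equals 1 for all sufficiently small h. -/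
open Set Filter MeasureTheory ProbabilityTheory

/-- The weighted kernel `y ↦ h⁻¹ K((σ₀ y - x)/h) ν(y) y` is continuous with compact support. -/
lemma kernel_gaussian_continuous_hasCompactSupport {K : ℝ → ℝ} (hK : Continuous K)
    (hsupp : ∀ u, K u ≠ 0 → u ∈ Set.Icc (-1 : ℝ) 1) {σ₀ x h : ℝ} (hσ₀ : 0 < σ₀) (hh : 0 < h) :
    Continuous (fun y : ℝ ↦ (1 / h) * K ((σ₀ * y - x) / h) * gaussianPDFReal 0 1 y * y) ∧
      HasCompactSupport
        (fun y : ℝ ↦ (1 / h) * K ((σ₀ * y - x) / h) * gaussianPDFReal 0 1 y * y) := by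
  constructor
  · have hν : Continuous (gaussianPDFReal 0 1) := by
      unfold gaussianPDFReal
      fun_prop
    fun_prop
  · refine HasCompactSupport.intro (isCompact_Icc (a := (x - h) / σ₀) (b := (x + h) / σ₀)) ?_
    intro y hy
    suffices hz : K ((σ₀ * y - x) / h) = 0 by simp [hz]
    by_contra hne
    obtain ⟨h1, h2⟩ := hsupp _ hne
    rw [le_div_iff₀ hh] at h1
    rw [div_le_iff₀ hh] at h2
    refine hy ⟨?_, ?_⟩
    · rw [div_le_iff₀ hσ₀]; linarith
    · rw [le_div_iff₀ hσ₀]; linarith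

lemma integral_kernel_gaussian_pos {K : ℝ → ℝ} (hK : Continuous K) (hKnn : ∀ y, 0 ≤ K y)
    (hsupp : ∀ u, K u ≠ 0 → u ∈ Set.Icc (-1 : ℝ) 1) (hne : ∃ u, K u ≠ 0)
    {σ₀ x h : ℝ} (hσ₀ : 0 < σ₀) (hh : 0 < h) (hhx : h < x) :
    0 < ∫ y : ℝ, (1 / h) * K ((σ₀ * y - x) / h) * gaussianPDFReal 0 1 y * y := by
  obtain ⟨hcont, hcomp⟩ :=
    kernel_gaussian_continuous_hasCompactSupport hK hsupp (x := x) hσ₀ hh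
  have hpos : ∀ y, K ((σ₀ * y - x) / h) ≠ 0 → 0 < y := by
    intro y hy
    have h1 := (hsupp _ hy).1
    rw [le_div_iff₀ hh] at h1
    exact pos_of_mul_pos_right (by linarith : 0 < σ₀ * y) hσ₀.le
  have hν : ∀ y, 0 < gaussianPDFReal 0 1 y := fun y ↦ gaussianPDFReal_pos 0 1 y one_ne_zero
  obtain ⟨u, hu⟩ := hne
  have hu' : (σ₀ * ((h * u + x) / σ₀) - x) / h = u := by
    field_simp
    ring
  refine hcont.integral_pos_of_hasCompactSupport_nonneg_nonzero hcomp (x := (h * u + x) / σ₀)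
    (fun y ↦ ?_) ?_
  · by_cases hy : K ((σ₀ * y - x) / h) = 0
    · simp [hy]
    · have := hpos y hy
      have := hKnn ((σ₀ * y - x) / h)
      have := hν y
      simp only [Pi.zero_apply]
      positivity
  · have hy := hpos ((h * u + x) / σ₀) (by rwa [hu'])
    rw [hu']
    exact mul_ne_zero (mul_ne_zero (mul_ne_zero (by positivity) hu) (hν _).ne') hy.ne'

lemma integral_kernel_gaussian_neg {K : ℝ → ℝ} (hK : Continuous K) (hKnn : ∀ y, 0 ≤ K y)
    (hsupp : ∀ u, K u ≠ 0 → u ∈ Set.Icc (-1 : ℝ) 1) (hne : ∃ u, K u ≠ 0)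
    {σ₀ x h : ℝ} (hσ₀ : 0 < σ₀) (hh : 0 < h) (hhx : h < -x) :
    (∫ y : ℝ, (1 / h) * K ((σ₀ * y - x) / h) * gaussianPDFReal 0 1 y * y) < 0 := by
  obtain ⟨u, hu⟩ := hne
  have key := integral_kernel_gaussian_pos (K := fun u ↦ K (-u)) (by fun_prop)
    (fun y ↦ hKnn _) (fun v hv ↦ by
      obtain ⟨h1, h2⟩ := hsupp _ hv
      constructor <;> linarith) ⟨-u, by simpa using hu⟩ hσ₀ hh hhx
  rw [← integral_neg_eq_self, ← neg_pos, ← integral_neg]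
  convert key using 3 with y
  have hν : gaussianPDFReal 0 1 (-y) = gaussianPDFReal 0 1 y := by simp [gaussianPDFReal]
  have hy : (σ₀ * -y - x) / h = -((σ₀ * y - -x) / h) := by ring
  rw [hν, hy]
  ring

/-- Since the standard normal law is centered, centering a functional does not change its first
Hermite coefficient. -/
lemma integral_sub_const_mul_gaussianPDFReal {A : ℝ → ℝ}
    (hA : Integrable (fun y ↦ A y * gaussianPDFReal 0 1 y * y)) (c : ℝ) :
    (∫ y : ℝ, (A y - c) * y * gaussianPDFReal 0 1 y) =
      ∫ y : ℝ, A y * gaussianPDFReal 0 1 y * y := by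
  have hint : Integrable (fun y : ℝ ↦ gaussianPDFReal 0 1 y * y) := by
    have := (integrable_mul_exp_neg_mul_sq (b := 1 / 2) (by norm_num)).const_mul
      (√(2 * Real.pi))⁻¹
    convert this using 2 with y
    simp only [gaussianPDFReal, NNReal.coe_one, mul_one, sub_zero]
    ring_nf
  have hzero : ∫ y : ℝ, gaussianPDFReal 0 1 y * y = 0 := by
    have h := integral_neg_eq_self (fun y : ℝ ↦ gaussianPDFReal 0 1 y * y) volume
    have hν : ∀ y, gaussianPDFReal 0 1 (-y) = gaussianPDFReal 0 1 y := by simp [gaussianPDFReal]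
    simp only [hν, mul_neg, integral_neg] at h
    linarith
  calc (∫ y : ℝ, (A y - c) * y * gaussianPDFReal 0 1 y)
      = ∫ y : ℝ, (A y * gaussianPDFReal 0 1 y * y - c * (gaussianPDFReal 0 1 y * y)) := by
        congr 1; ext y; ring
    _ = _ := by rw [integral_sub hA (hint.const_mul c), integral_const_mul, hzero]; ring

/-- Sign of the first Hermite coefficient of the centered kernel functional
`G_{h,x}(y) = (1/h)K((σ₀y - x)/h) - 𝔼[(1/h)K((σ₀U - x)/h)]`: for `x > 0` and `h ∈ (0,x)` the
integral `∫ (1/h)K((σ₀y - x)/h) ν(y) y dy` is strictly positive, symmetrically strictly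
negative for `x < 0` and `h ∈ (0,-x)`; in particular the first Hermite coefficient
`J(1) = 𝔼[G_{h,x}(U) H_1(U)]` is nonzero, so the Hermite rank of `G_{h,x}` equals `1`
for all sufficiently small `h`. -/
theorem kernel_first_hermite_coefficient_nonzero
    (K : ℝ → ℝ) (hK : ContDiff ℝ 1 K) (hKnn : ∀ y, 0 ≤ K y)
    (hsupp : tsupport K = Set.Icc (-1 : ℝ) 1) (hKint : (∫ y : ℝ, K y) = 1)
    (σ₀ : ℝ) (hσ₀ : 0 < σ₀) :
    (∀ x : ℝ, 0 < x → ∀ h ∈ Set.Ioo (0 : ℝ) x,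
      0 < ∫ y : ℝ, (1 / h) * K ((σ₀ * y - x) / h) * gaussianPDFReal 0 1 y * y) ∧
    (∀ x : ℝ, x < 0 → ∀ h ∈ Set.Ioo (0 : ℝ) (-x),
      (∫ y : ℝ, (1 / h) * K ((σ₀ * y - x) / h) * gaussianPDFReal 0 1 y * y) < 0) ∧
    (∀ x : ℝ, x ≠ 0 → ∀ h ∈ Set.Ioo (0 : ℝ) |x|,
      (∫ y : ℝ,
        ((1 / h) * K ((σ₀ * y - x) / h) -
          ∫ z : ℝ, (1 / h) * K ((σ₀ * z - x) / h) * gaussianPDFReal 0 1 z) * y *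
            gaussianPDFReal 0 1 y) ≠ 0) := by
  have hsupp' : ∀ u, K u ≠ 0 → u ∈ Set.Icc (-1 : ℝ) 1 := fun u hu ↦
    hsupp ▸ subset_tsupport K hu
  have hne : ∃ u, K u ≠ 0 := by
    by_contra! h
    simp [h] at hKint
  have hpos : ∀ x : ℝ, 0 < x → ∀ h ∈ Set.Ioo (0 : ℝ) x,
      0 < ∫ y : ℝ, (1 / h) * K ((σ₀ * y - x) / h) * gaussianPDFReal 0 1 y * y :=
    fun x _ h hh ↦ integral_kernel_gaussian_pos hK.continuous hKnn hsupp' hne hσ₀ hh.1 hh.2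
  have hneg : ∀ x : ℝ, x < 0 → ∀ h ∈ Set.Ioo (0 : ℝ) (-x),
      (∫ y : ℝ, (1 / h) * K ((σ₀ * y - x) / h) * gaussianPDFReal 0 1 y * y) < 0 :=
    fun x _ h hh ↦ integral_kernel_gaussian_neg hK.continuous hKnn hsupp' hne hσ₀ hh.1 hh.2
  refine ⟨hpos, hneg, fun x hx h hh ↦ ?_⟩
  obtain ⟨hcont, hcomp⟩ :=
    kernel_gaussian_continuous_hasCompactSupport hK.continuous hsupp' (x := x) hσ₀ hh.1
  rw [integral_sub_const_mul_gaussianPDFReal (hcont.integrable_of_hasCompactSupport hcomp)]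
  rcases lt_or_gt_of_ne hx with hx | hx
  · exact (hneg x hx h (abs_of_neg hx ▸ hh)).ne
  · exact (hpos x hx h (abs_of_pos hx ▸ hh)).ne'
end

section
/- Let H ∈ (1/2,1), σ₀ > 0, x ∈ ℝ \ {0}, let ρ : ℝ → [−1,1] be measurable with ∫₀ᵀ∫₀ᵀ |ρ(v−u)| du dv = O(T^{2H}) as T → ∞, and let (Y(s))_{s≥0} be a measurable real-valued stochastic process such that for all u, v ≥ 0 the pair (Y(u), Y(v)) is centered Gaussian with unit variances and covariance ρ(v−u). Set X := σ₀ Y. Let K : ℝ → ℝ₊ be continuously differentiable with supp(K) = [−1,1] and ∫K = 1, and let h : [t₀,∞) → (0,1) be decreasing with h(T) → 0, T h(T) → ∞ and T^{2H−2} = o(h(T)) as T → ∞. Then f̂_{T,h(T)}(x) := (1/(T h(T))) ∫₀ᵀ K((X(s) − x)/h(T)) ds converges in probability, as T → ∞, to (1/σ₀) ν(x/σ₀) > 0, where ν is the standard normal density. -/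
open Set Filter MeasureTheory ProbabilityTheory Asymptotics Topology

lemma gaussianPDFReal_zero_one_le_one (y : ℝ) : gaussianPDFReal 0 1 y ≤ 1 := by
  have h1 : (Real.sqrt (2 * Real.pi))⁻¹ ≤ 1 := by
    apply inv_le_one_of_one_le₀
    rw [Real.one_le_sqrt]
    linarith [Real.pi_gt_three]
  have h2 : Real.exp (-(y - 0) ^ 2 / (2 * 1)) ≤ 1 := by
    rw [Real.exp_le_one_iff]
    nlinarith [sq_nonneg y]
  simp only [gaussianPDFReal, NNReal.coe_one, mul_one] at *
  exact mul_le_one₀ h1 (Real.exp_pos _).le h2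

lemma exp_neg_le_exp_neg_add {a b d : ℝ} (ha : 0 ≤ a) (hd : 0 ≤ d) (hbd : b - a ≤ d) :
    Real.exp (-a) ≤ Real.exp (-b) + d := by
  have h1 : Real.exp (-b) = Real.exp (-a) * Real.exp (-(b - a)) := by
    rw [← Real.exp_add]; ring_nf
  have h2 := Real.add_one_le_exp (-(b - a))
  have h3 : Real.exp (-a) ≤ 1 := Real.exp_le_one_iff.mpr (by linarith)
  have h4 := Real.exp_pos (-a)
  rw [h1]
  nlinarith [mul_le_mul_of_nonneg_left h2 h4.le]

/-- Uniform control of the correlated conditional Gaussian density by the uncorrelated one. -/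
lemma gaussianPDFReal_correlated_le {M r y z : ℝ} (hr : |r| ≤ 1 / 2) (hy : |y| ≤ M)
    (hz : |z| ≤ M) :
    gaussianPDFReal (r * z) (1 - r ^ 2).toNNReal y
      ≤ gaussianPDFReal 0 1 y + (2 * M ^ 2 + 2) * |r| := by
  have hr0 := abs_nonneg r
  have hM : 0 ≤ M := (abs_nonneg y).trans hy
  have hrsq : r ^ 2 = |r| ^ 2 := (sq_abs r).symm
  have hv : 3 / 4 ≤ 1 - r ^ 2 := by rw [hrsq]; nlinarith
  have hv0 : 0 ≤ 1 - r ^ 2 := by linarith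
  have hsqrt : 1 - |r| ≤ Real.sqrt (1 - r ^ 2) :=
    Real.le_sqrt_of_sq_le (by rw [hrsq]; nlinarith)
  have hinv : (Real.sqrt (1 - r ^ 2))⁻¹ ≤ 1 + 2 * |r| := by
    rw [inv_le_iff_one_le_mul₀ (by linarith)]
    nlinarith
  have hpi : (Real.sqrt (2 * Real.pi))⁻¹ ≤ 1 := by
    apply inv_le_one_of_one_le₀
    rw [Real.one_le_sqrt]
    linarith [Real.pi_gt_three]
  have hpi0 : 0 ≤ (Real.sqrt (2 * Real.pi))⁻¹ := by positivity
  have hyz : r * y * z ≤ |r| * M ^ 2 := by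
    refine (le_abs_self _).trans ?_
    rw [abs_mul, abs_mul, mul_assoc, sq]
    gcongr
  have hexp : Real.exp (-((y - r * z) ^ 2 / (2 * (1 - r ^ 2))))
      ≤ Real.exp (-(y ^ 2 / 2)) + 2 * M ^ 2 * |r| := by
    apply exp_neg_le_exp_neg_add (by positivity) (by positivity)
    rw [div_sub_div _ _ (by norm_num) (by positivity), div_le_iff₀ (by positivity)]
    have h1 : 0 ≤ |r| * M ^ 2 := by positivity
    have h2 : |r| * M ^ 2 * (3 / 4) ≤ |r| * M ^ 2 * (1 - r ^ 2) := by gcongr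
    nlinarith [sq_nonneg (r * z), sq_nonneg (r * y)]
  have hexp1 : Real.exp (-((y - r * z) ^ 2 / (2 * (1 - r ^ 2)))) ≤ 1 :=
    Real.exp_le_one_iff.mpr (neg_nonpos.mpr (by positivity))
  have hexp0 := Real.exp_pos (-((y - r * z) ^ 2 / (2 * (1 - r ^ 2))))
  simp only [gaussianPDFReal, Real.coe_toNNReal _ hv0, NNReal.coe_one, mul_one, sub_zero,
    Real.sqrt_mul (by positivity : 0 ≤ 2 * Real.pi), neg_div, mul_inv]
  generalize Real.exp (-((y - r * z) ^ 2 / (2 * (1 - r ^ 2)))) = A at *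
  generalize Real.exp (-(y ^ 2 / 2)) = B at *
  generalize (Real.sqrt (1 - r ^ 2))⁻¹ = S at *
  generalize (Real.sqrt (2 * Real.pi))⁻¹ = P at *
  calc P * S * A ≤ P * (1 + 2 * |r|) * A := by gcongr
    _ = P * A + 2 * |r| * (P * A) := by ring
    _ ≤ P * (B + 2 * M ^ 2 * |r|) + 2 * |r| * (1 * 1) := by gcongr
    _ = P * B + P * (2 * M ^ 2 * |r|) + 2 * |r| := by ring
    _ ≤ P * B + 1 * (2 * M ^ 2 * |r|) + 2 * |r| := by gcongr
    _ = _ := by ring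

lemma gaussianReal_prod_map_linear (a b : ℝ) :
    ((gaussianReal 0 1).prod (gaussianReal 0 1)).map (fun p => a * p.1 + b * p.2)
      = gaussianReal 0 (a ^ 2 + b ^ 2).toNNReal := by
  have hm : ∀ c : ℝ, (gaussianReal 0 1).map (fun t => c * t) = gaussianReal 0 (c ^ 2).toNNReal := by
    intro c
    rw [gaussianReal_map_const_mul, mul_zero, mul_one]
    congr 1
    exact (Real.toNNReal_of_nonneg (sq_nonneg c)).symm
  have hind : IndepFun (fun p : ℝ × ℝ => a * p.1) (fun p => b * p.2)
      ((gaussianReal 0 1).prod (gaussianReal 0 1)) :=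
    indepFun_prod (X := fun t => a * t) (Y := fun t => b * t) (by fun_prop) (by fun_prop)
  have h1 : ((gaussianReal 0 1).prod (gaussianReal 0 1)).map (fun p : ℝ × ℝ => a * p.1)
      = gaussianReal 0 (a ^ 2).toNNReal := by
    rw [← hm a, ← Function.comp_def (fun t => a * t) Prod.fst,
      ← Measure.map_map (by fun_prop) (by fun_prop), Measure.map_fst_prod, measure_univ, one_smul]
  have h2 : ((gaussianReal 0 1).prod (gaussianReal 0 1)).map (fun p : ℝ × ℝ => b * p.2)
      = gaussianReal 0 (b ^ 2).toNNReal := by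
    rw [← hm b, ← Function.comp_def (fun t => b * t) Prod.snd,
      ← Measure.map_map (by fun_prop) (by fun_prop), Measure.map_snd_prod, measure_univ, one_smul]
  have h3 := gaussianReal_add_gaussianReal_of_indepFun hind h1 h2
  rw [add_zero, ← Real.toNNReal_add (sq_nonneg a) (sq_nonneg b)] at h3
  exact h3

/-- A pair all of whose linear combinations are centered Gaussian with the covariance structure of
a standard pair with correlation `r` is distributed as `(Z₁, r Z₁ + √(1 - r²) Z₂)`. -/
lemma map_prodMk_eq_of_map_linear {Ω : Type*} [MeasurableSpace Ω] {μ : Measure Ω}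
    [IsProbabilityMeasure μ] {U V : Ω → ℝ} (hU : Measurable U) (hV : Measurable V) {r : ℝ}
    (hr : r ^ 2 ≤ 1)
    (hlin : ∀ a b : ℝ, μ.map (fun ω => a * U ω + b * V ω)
      = gaussianReal 0 (a ^ 2 + 2 * a * b * r + b ^ 2).toNNReal) :
    μ.map (fun ω => (U ω, V ω))
      = ((gaussianReal 0 1).prod (gaussianReal 0 1)).map
        (fun p => (p.1, r * p.1 + Real.sqrt (1 - r ^ 2) * p.2)) := by
  have : IsProbabilityMeasure (μ.map (fun ω => (U ω, V ω))) :=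
    Measure.isProbabilityMeasure_map (by fun_prop)
  apply Measure.ext_of_charFunDual
  ext L
  have hL : ∀ p : ℝ × ℝ, L p = L (1, 0) * p.1 + L (0, 1) * p.2 := by
    intro p
    have : p = p.1 • ((1 : ℝ), (0 : ℝ)) + p.2 • ((0 : ℝ), (1 : ℝ)) := by ext <;> simp
    conv_lhs => rw [this, map_add, map_smul, map_smul]
    simp only [smul_eq_mul]; ring
  rw [charFunDual_eq_charFun_map_one, charFunDual_eq_charFun_map_one,
    Measure.map_map (by fun_prop) (by fun_prop), Measure.map_map (by fun_prop) (by fun_prop)]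
  congr 1
  have e1 : (L ∘ fun ω => (U ω, V ω)) = fun ω => L (1, 0) * U ω + L (0, 1) * V ω := by
    ext ω; exact hL _
  have e2 : (L ∘ fun p : ℝ × ℝ => (p.1, r * p.1 + Real.sqrt (1 - r ^ 2) * p.2))
      = fun p => (L (1, 0) + L (0, 1) * r) * p.1 + (L (0, 1) * Real.sqrt (1 - r ^ 2)) * p.2 := by
    ext p; simp only [Function.comp, hL (p.1, _)]; ring
  rw [e1, e2, hlin, gaussianReal_prod_map_linear, mul_pow _ (Real.sqrt _),
    Real.sq_sqrt (by linarith)]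
  congr 2
  ring

/-- Covariance inequality: for bounded nonnegative compactly supported `f` and a standard Gaussian
pair with correlation `r`, the covariance of `f U` and `f V` is at most linear in `|r|`. -/
lemma integral_mul_comp_le_of_map_linear {Ω : Type*} [MeasurableSpace Ω] {μ : Measure Ω}
    [IsProbabilityMeasure μ] {U V : Ω → ℝ} (hU : Measurable U) (hV : Measurable V) {r : ℝ}
    (hr : |r| ≤ 1)
    (hlin : ∀ a b : ℝ, μ.map (fun ω => a * U ω + b * V ω)
      = gaussianReal 0 (a ^ 2 + 2 * a * b * r + b ^ 2).toNNReal)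
    {f : ℝ → ℝ} (hf : Measurable f) (hf0 : ∀ y, 0 ≤ f y) {B M : ℝ} (hfB : ∀ y, f y ≤ B)
    (hfM : ∀ y, f y ≠ 0 → |y| ≤ M) (hfint : Integrable f) :
    ∫ ω, f (U ω) * f (V ω) ∂μ ≤ (∫ y, f y ∂gaussianReal 0 1) ^ 2
      + (2 * B + (2 * M ^ 2 + 2) * ∫ y, f y) * (∫ y, f y ∂gaussianReal 0 1) * |r| := by
  have hB : 0 ≤ B := (hf0 0).trans (hfB 0)
  have hfin : ∀ (P : Measure ℝ) [IsFiniteMeasure P], Integrable f P := fun P _ => by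
    refine Integrable.of_bound hf.aestronglyMeasurable B (ae_of_all _ fun a => ?_)
    rw [Real.norm_of_nonneg (hf0 _)]; exact hfB _
  have hm0 : 0 ≤ ∫ y, f y ∂gaussianReal 0 1 := integral_nonneg hf0
  have hI0 : 0 ≤ ∫ y, f y := integral_nonneg hf0
  rcases le_or_gt |r| (1 / 2) with hr2 | hr2
  · have hr1 : r ^ 2 < 1 := by rw [← sq_abs]; nlinarith [abs_nonneg r]
    have hs : Real.sqrt (1 - r ^ 2) ^ 2 = 1 - r ^ 2 := Real.sq_sqrt (by linarith)
    have hpair := map_prodMk_eq_of_map_linear hU hV hr1.le hlin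
    have hF : Measurable (fun p : ℝ × ℝ => f p.1 * f p.2) := by fun_prop
    have e1 : ∫ ω, f (U ω) * f (V ω) ∂μ = ∫ p, f p.1 * f (r * p.1 + Real.sqrt (1 - r ^ 2) * p.2)
        ∂((gaussianReal 0 1).prod (gaussianReal 0 1)) := by
      have h1 := integral_map (μ := μ) (φ := fun ω => (U ω, V ω)) (by fun_prop)
        (f := fun p : ℝ × ℝ => f p.1 * f p.2) hF.aestronglyMeasurable
      rw [hpair, integral_map (by fun_prop) hF.aestronglyMeasurable] at h1
      exact h1.symm
    have hint : Integrable (fun p : ℝ × ℝ => f p.1 * f (r * p.1 + Real.sqrt (1 - r ^ 2) * p.2))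
        ((gaussianReal 0 1).prod (gaussianReal 0 1)) := by
      refine Integrable.of_bound (C := B * B) (by fun_prop) (ae_of_all _ fun p => ?_)
      rw [Real.norm_of_nonneg (mul_nonneg (hf0 _) (hf0 _))]
      exact mul_le_mul (hfB _) (hfB _) (hf0 _) hB
    rw [e1, integral_prod _ hint]
    have hv : (1 - r ^ 2).toNNReal ≠ 0 := by
      rw [Ne, Real.toNNReal_eq_zero]; linarith
    have hcond : ∀ z, ∫ w, f (r * z + Real.sqrt (1 - r ^ 2) * w) ∂gaussianReal 0 1
        = ∫ y, gaussianPDFReal (r * z) (1 - r ^ 2).toNNReal y * f y := by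
      intro z
      have h1 : (gaussianReal 0 1).map (fun w => r * z + Real.sqrt (1 - r ^ 2) * w)
          = gaussianReal (r * z) (1 - r ^ 2).toNNReal := by
        rw [← Function.comp_def (fun t => r * z + t) (fun w => Real.sqrt (1 - r ^ 2) * w),
          ← Measure.map_map (by fun_prop) (by fun_prop), gaussianReal_map_const_mul,
          gaussianReal_map_const_add, mul_zero, zero_add, mul_one]
        congr 1
        rw [Real.toNNReal_of_nonneg (by linarith)]
        exact NNReal.eq hs
      have h2 := integral_gaussianReal_eq_integral_smul (μ := r * z) (f := f) hv
      rw [← h1, integral_map (by fun_prop) hf.aestronglyMeasurable] at h2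
      simpa only [smul_eq_mul] using h2
    have hpdfint : ∀ (c : ℝ) (v : NNReal), Integrable (fun y => gaussianPDFReal c v y * f y) := by
      intro c v
      refine ((integrable_gaussianPDFReal c v).mul_const B).mono' (by fun_prop)
        (ae_of_all _ fun y => ?_)
      rw [Real.norm_of_nonneg (mul_nonneg (gaussianPDFReal_nonneg _ _ _) (hf0 _))]
      exact mul_le_mul_of_nonneg_left (hfB y) (gaussianPDFReal_nonneg _ _ _)
    have hm : ∫ y, f y ∂gaussianReal 0 1 = ∫ y, gaussianPDFReal 0 1 y * f y := by
      simpa only [smul_eq_mul] using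
        integral_gaussianReal_eq_integral_smul (μ := 0) (f := f) one_ne_zero
    have hbound : ∀ z, ∫ w, f z * f (r * z + Real.sqrt (1 - r ^ 2) * w) ∂gaussianReal 0 1
        ≤ f z * ((∫ y, f y ∂gaussianReal 0 1) + (2 * M ^ 2 + 2) * |r| * ∫ y, f y) := by
      intro z
      rw [integral_const_mul, hcond]
      by_cases hz : f z = 0
      · simp [hz]
      refine mul_le_mul_of_nonneg_left ?_ (hf0 z)
      rw [hm, ← integral_const_mul, ← integral_add (hpdfint _ _) (hfint.const_mul _)]
      refine integral_mono (hpdfint _ _) ((hpdfint _ _).add (hfint.const_mul _)) fun y => ?_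
      by_cases hy : f y = 0
      · simp [hy]
      have := gaussianPDFReal_correlated_le hr2 (hfM y hy) (hfM z hz)
      calc _ ≤ _ := mul_le_mul_of_nonneg_right this (hf0 y)
        _ = _ := by ring
    refine (integral_mono hint.integral_prod_left ((hfin _).mul_const _)
      hbound).trans ?_
    rw [integral_mul_const]
    have : 0 ≤ 2 * B * (∫ y, f y ∂gaussianReal 0 1) * |r| := by positivity
    nlinarith
  · have hfV : Integrable (fun ω => f (V ω)) μ :=
      (hfin (μ.map V)).comp_measurable hV
    have hVlaw : μ.map V = gaussianReal 0 1 := by simpa using hlin 0 1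
    have h1 : ∫ ω, f (V ω) ∂μ = ∫ y, f y ∂gaussianReal 0 1 := by
      rw [← hVlaw, integral_map hV.aemeasurable hf.aestronglyMeasurable]
    have h2 : ∫ ω, f (U ω) * f (V ω) ∂μ ≤ ∫ ω, B * f (V ω) ∂μ := by
      refine integral_mono ?_ (hfV.const_mul _)
        fun ω => mul_le_mul_of_nonneg_right (hfB _) (hf0 _)
      refine (hfV.const_mul B).mono' (by fun_prop) (ae_of_all _ fun ω => ?_)
      rw [Real.norm_of_nonneg (mul_nonneg (hf0 _) (hf0 _))]
      exact mul_le_mul_of_nonneg_right (hfB _) (hf0 _)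
    rw [integral_const_mul, h1] at h2
    have h3 : 0 ≤ (2 * M ^ 2 + 2) * (∫ y, f y) * (∫ y, f y ∂gaussianReal 0 1) * |r| := by positivity
    have h4 : 0 ≤ B * ∫ y, f y ∂gaussianReal 0 1 := by positivity
    nlinarith [sq_nonneg (∫ y, f y ∂gaussianReal 0 1)]

/-- Chebyshev's inequality for a time integral of a bounded process. -/
lemma sq_mul_measureReal_le_abs_integral_le {S Ω : Type*} [MeasurableSpace S] [MeasurableSpace Ω]
    {τ : Measure S} [IsFiniteMeasure τ] {μ : Measure Ω} [IsFiniteMeasure μ] {F : S → Ω → ℝ}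
    (hF : Measurable (fun p : S × Ω => F p.1 p.2)) {B : ℝ} (hB : ∀ s ω, |F s ω| ≤ B)
    {R : S × S → ℝ} (hR : Integrable R (τ.prod τ))
    (hcov : ∀ᵐ p ∂τ.prod τ, ∫ ω, F p.1 ω * F p.2 ω ∂μ ≤ R p) {ε : ℝ} (hε : 0 ≤ ε) :
    ε ^ 2 * μ.real {ω | ε ≤ |∫ s, F s ω ∂τ|} ≤ ∫ p, R p ∂τ.prod τ := by
  have hFm : Measurable (fun q : Ω × (S × S) => F q.2.1 q.1 * F q.2.2 q.1) :=
    (hF.comp (f := fun q : Ω × (S × S) => (q.2.1, q.1)) (by fun_prop)).mul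
      (hF.comp (f := fun q : Ω × (S × S) => (q.2.2, q.1)) (by fun_prop))
  have hint : Integrable (fun q : Ω × (S × S) => F q.2.1 q.1 * F q.2.2 q.1)
      (μ.prod (τ.prod τ)) := by
    refine Integrable.of_bound (C := B * B) hFm.aestronglyMeasurable (ae_of_all _ fun q => ?_)
    rw [norm_mul]
    exact mul_le_mul (hB _ _) (hB _ _) (norm_nonneg _) ((abs_nonneg _).trans (hB q.2.1 q.1))
  have h1 : ∀ ω, (∫ s, F s ω ∂τ) ^ 2 = ∫ p, F p.1 ω * F p.2 ω ∂τ.prod τ := fun ω => by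
    rw [integral_prod_mul (fun s => F s ω) (fun s => F s ω), sq]
  have h2 : {ω | ε ≤ |∫ s, F s ω ∂τ|}
      = {ω | ε ^ 2 ≤ ∫ p : S × S, F p.1 ω * F p.2 ω ∂τ.prod τ} := by
    ext ω
    rw [mem_ofPred_eq, mem_ofPred_eq, ← h1, sq_le_sq, abs_of_nonneg hε]
  rw [h2]
  refine (mul_meas_ge_le_integral_of_nonneg (ae_of_all _ fun ω => ?_)
    hint.integral_prod_left _).trans ?_
  · simp only [← h1]
    exact sq_nonneg _
  · rw [integral_integral_swap (f := fun ω (p : S × S) => F p.1 ω * F p.2 ω) hint]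
    exact integral_mono_ae hint.integral_prod_right hR hcov

/-- Rescaling of a kernel around the point `x / σ`. -/
lemma integral_comp_affine_div {σ h x : ℝ} (hσ : 0 < σ) (hh : 0 < h) (g : ℝ → ℝ) :
    ∫ y, g ((σ * y - x) / h) = h / σ * ∫ z, g z := by
  have h1 : ∀ y, (σ * y - x) / h = (y - x / σ) / (h / σ) := fun y => by field_simp
  simp_rw [h1]
  rw [integral_sub_right_eq_self (fun y => g (y / (h / σ))) (x / σ), Measure.integral_comp_div,
    abs_of_pos (by positivity), smul_eq_mul]

/-- Expected value of a shrinking kernel under a Gaussian law. -/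
lemma tendsto_integral_kernel_gaussianReal {ι : Type*} {l : Filter ι} [l.IsCountablyGenerated]
    {K : ℝ → ℝ} (hK : Measurable K) (hKint : Integrable K) {σ : ℝ} (hσ : 0 < σ) (x : ℝ)
    {h : ι → ℝ} (hpos : ∀ᶠ i in l, 0 < h i) (hto : Tendsto h l (𝓝 0)) :
    Tendsto (fun i => (∫ y, K ((σ * y - x) / h i) ∂gaussianReal 0 1) / h i) l
      (𝓝 ((∫ z, K z) * (1 / σ * gaussianPDFReal 0 1 (x / σ)))) := by
  have hcont : Continuous (gaussianPDFReal 0 1) := by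
    unfold gaussianPDFReal; fun_prop
  have key : Tendsto (fun i => ∫ z, 1 / σ * gaussianPDFReal 0 1 ((h i * z + x) / σ) * K z) l
      (𝓝 (∫ z, 1 / σ * gaussianPDFReal 0 1 (x / σ) * K z)) := by
    refine tendsto_integral_filter_of_dominated_convergence (fun z => 1 / σ * ‖K z‖)
      (Eventually.of_forall fun i => ?_) (Eventually.of_forall fun i => ae_of_all _ fun z => ?_)
      (hKint.norm.const_mul _) (ae_of_all _ fun z => ?_)
    · exact Measurable.aestronglyMeasurable (by fun_prop)
    · rw [norm_mul, norm_mul, Real.norm_of_nonneg (gaussianPDFReal_nonneg _ _ _),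
        Real.norm_of_nonneg (by positivity : 0 ≤ 1 / σ)]
      refine mul_le_mul_of_nonneg_right ?_ (norm_nonneg _)
      exact mul_le_of_le_one_right (by positivity) (gaussianPDFReal_zero_one_le_one _)
    · have h1 : Tendsto (fun i => (h i * z + x) / σ) l (𝓝 (x / σ)) := by
        have := ((hto.mul_const z).add_const x).div_const σ
        simpa using this
      exact (((hcont.tendsto _).comp h1).const_mul _).mul_const _
  rw [integral_const_mul, mul_comm] at key
  refine key.congr' ?_
  filter_upwards [hpos] with i hi
  rw [integral_gaussianReal_eq_integral_smul one_ne_zero, eq_div_iff hi.ne']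
  have h1 : ∀ y, gaussianPDFReal 0 1 y • K ((σ * y - x) / h i)
      = (fun z => gaussianPDFReal 0 1 ((h i * z + x) / σ) * K z) ((σ * y - x) / h i) := by
    intro y
    have : (h i * ((σ * y - x) / h i) + x) / σ = y := by field_simp; ring
    simp only [smul_eq_mul, this]
  rw [integral_congr_ae (ae_of_all _ h1),
    integral_comp_affine_div hσ hi (fun z => gaussianPDFReal 0 1 ((h i * z + x) / σ) * K z)]
  simp_rw [mul_assoc]
  rw [integral_const_mul]
  ring

/-- Consistency of the kernel density functional `f̂_{T,h(T)}(x)` for a stationary Gaussian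
process: if `X = σ₀ Y` where `Y` is a normalized stationary Gaussian process with
autocorrelation `ρ` satisfying `∫₀ᵀ∫₀ᵀ |ρ(v-u)| du dv = O(T^{2H})`, and the bandwidth
`h(T) → 0` satisfies `T h(T) → ∞` and `T^{2H-2} = o(h(T))`, then
`f̂_{T,h(T)}(x) = (1/(T h(T))) ∫₀ᵀ K((X(s) - x)/h(T)) ds` converges in probability to
`(1/σ₀) ν(x/σ₀) > 0`. -/
theorem kernel_density_functional_consistency
    {Ω : Type*} [MeasurableSpace Ω] (μ : Measure Ω) [IsProbabilityMeasure μ]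
    (H : ℝ) (hH : H ∈ Set.Ioo (1 / 2 : ℝ) 1) (σ₀ : ℝ) (hσ₀ : 0 < σ₀) (x : ℝ) (hx : x ≠ 0)
    (ρ : ℝ → ℝ) (hρmeas : Measurable ρ) (hρbdd : ∀ s : ℝ, ρ s ∈ Set.Icc (-1 : ℝ) 1)
    (hρO : (fun T : ℝ => ∫ u in (0 : ℝ)..T, ∫ v in (0 : ℝ)..T, |ρ (v - u)|)
      =O[atTop] fun T : ℝ => T ^ (2 * H))
    (Y : ℝ → Ω → ℝ) (hYmeas : Measurable (fun p : ℝ × Ω => Y p.1 p.2))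
    (hgauss : ∀ u v : ℝ, 0 ≤ u → 0 ≤ v → ∀ a b : ℝ,
      Measure.map (fun ω => a * Y u ω + b * Y v ω) μ =
        gaussianReal 0 (Real.toNNReal (a ^ 2 + 2 * a * b * ρ (v - u) + b ^ 2)))
    (K : ℝ → ℝ) (hK : ContDiff ℝ 1 K) (hKnn : ∀ y, 0 ≤ K y)
    (hsupp : tsupport K = Set.Icc (-1 : ℝ) 1) (hKint : (∫ y : ℝ, K y) = 1)
    (t₀ : ℝ) (h : ℝ → ℝ) (hdecr : AntitoneOn h (Set.Ici t₀))
    (hrange : ∀ T ∈ Set.Ici t₀, h T ∈ Set.Ioo (0 : ℝ) 1)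
    (hto0 : Tendsto h atTop (𝓝 0))
    (hTh : Tendsto (fun T => T * h T) atTop atTop)
    (hlittleo : (fun T : ℝ => T ^ (2 * H - 2)) =o[atTop] h) :
    TendstoInMeasure μ
      (fun T : ℝ => fun ω =>
        (1 / (T * h T)) * ∫ s in (0 : ℝ)..T, K ((σ₀ * Y s ω - x) / h T))
      atTop (fun _ => (1 / σ₀) * gaussianPDFReal 0 1 (x / σ₀)) ∧
    0 < (1 / σ₀) * gaussianPDFReal 0 1 (x / σ₀) := by
  have hcpos : 0 < (1 / σ₀) * gaussianPDFReal 0 1 (x / σ₀) :=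
    mul_pos (by positivity) (gaussianPDFReal_pos _ _ _ one_ne_zero)
  refine ⟨?_, hcpos⟩
  have hcs : HasCompactSupport K := by
    rw [HasCompactSupport, hsupp]; exact isCompact_Icc
  have hKi : Integrable K := hK.continuous.integrable_of_hasCompactSupport hcs
  have hKm : Measurable K := hK.continuous.measurable
  obtain ⟨B, hB⟩ := hcs.exists_bound_of_continuous hK.continuous
  have hKB : ∀ y, K y ≤ B := fun y => (le_abs_self _).trans (hB y)
  have hKs : ∀ y, K y ≠ 0 → |y| ≤ 1 := fun y hy => by
    have := subset_tsupport K (Function.mem_support.mpr hy)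
    rw [hsupp] at this
    exact abs_le.mpr this
  have hB0 : 0 ≤ B := (hKnn 0).trans (hKB 0)
  have hev : ∀ᶠ T in atTop, 0 < T ∧ h T ∈ Set.Ioo (0 : ℝ) 1 := by
    filter_upwards [eventually_gt_atTop 0, eventually_ge_atTop t₀] with T h1 h2
    exact ⟨h1, hrange T h2⟩
  have hmean := tendsto_integral_kernel_gaussianReal hKm hKi hσ₀ x
    (hev.mono fun T hT => hT.2.1) hto0
  rw [hKint, one_mul] at hmean
  generalize (1 / σ₀) * gaussianPDFReal 0 1 (x / σ₀) = c at *
  set m : ℝ → ℝ := fun T => ∫ y, K ((σ₀ * y - x) / h T) ∂gaussianReal 0 1 with hm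
  set J : ℝ → ℝ := fun T => ∫ u in (0 : ℝ)..T, ∫ v in (0 : ℝ)..T, |ρ (v - u)| with hJ
  set M : ℝ := (|x| + 1) / σ₀ with hM
  set D : ℝ := (2 * B + (2 * M ^ 2 + 2) * (1 / σ₀)) * (1 / σ₀) with hD
  have hYs : ∀ s, Measurable (Y s) := fun s => hYmeas.comp measurable_prodMk_left
  have hbound : ∀ ε > 0, ∀ᶠ T in atTop,
      μ.real {ω | ε ≤ ‖(1 / (T * h T)) * (∫ s in (0 : ℝ)..T, K ((σ₀ * Y s ω - x) / h T)) - c‖}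
        ≤ ((m T / h T - c) ^ 2 + D * (J T / (T ^ 2 * h T))) / ε ^ 2 := by
    intro ε hε
    filter_upwards [hev] with T ⟨hT, hh0, hh1⟩
    set f : ℝ → ℝ := fun y => K ((σ₀ * y - x) / h T) with hf
    have hfm : Measurable f := by fun_prop
    have hfM : ∀ y, f y ≠ 0 → |y| ≤ M := fun y hy => by
      have h1 := hKs _ hy
      rw [abs_div, abs_of_pos hh0, div_le_one hh0] at h1
      rw [hM, le_div_iff₀ hσ₀]
      have h2 := abs_sub_abs_le_abs_sub (σ₀ * y) x
      rw [abs_mul, abs_of_pos hσ₀] at h2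
      linarith
    have hfint : Integrable f :=
      Continuous.integrable_of_hasCompactSupport
        (hK.continuous.comp (by fun_prop : Continuous fun y => (σ₀ * y - x) / h T))
        (HasCompactSupport.intro (isCompact_Icc (a := -M) (b := M)) fun y hy => by
          by_contra hne
          exact hy (abs_le.mp (hfM y hne)))
    have hfI : ∫ y, f y = h T / σ₀ := by
      rw [hf, integral_comp_affine_div hσ₀ hh0 K, hKint, mul_one]
    have hfγ : ∀ (P : Measure ℝ) [IsFiniteMeasure P], Integrable f P := fun P _ =>
      Integrable.of_bound hfm.aestronglyMeasurable B (ae_of_all _ fun a => hB _)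
    have hm0 : 0 ≤ m T := integral_nonneg fun y => hKnn _
    have hmle : m T ≤ h T / σ₀ := by
      rw [← hfI]
      simp only [hm]
      rw [integral_gaussianReal_eq_integral_smul one_ne_zero]
      have hle : ∀ y, gaussianPDFReal 0 1 y • f y ≤ f y := fun y =>
        mul_le_of_le_one_left (hKnn _) (gaussianPDFReal_zero_one_le_one y)
      refine integral_mono (hfint.mono' (by fun_prop) (ae_of_all _ fun y => ?_)) hfint hle
      exact (Real.norm_of_nonneg (mul_nonneg (gaussianPDFReal_nonneg _ _ _) (hKnn _))).trans_le
        (hle y)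
    have hlaw : ∀ s, 0 ≤ s → ∫ ω, f (Y s ω) ∂μ = m T := fun s hs => by
      have h1 : μ.map (Y s) = gaussianReal 0 1 := by simpa using hgauss s s hs hs 1 0
      simp only [hm]
      rw [← h1, integral_map (hYs s).aemeasurable hfm.aestronglyMeasurable]
    have hfYint : ∀ s, Integrable (fun ω => f (Y s ω)) μ := fun s =>
      (hfγ (μ.map (Y s))).comp_measurable (hYs s)
    have hcov : ∀ u v, 0 ≤ u → 0 ≤ v → ∫ ω, (f (Y u ω) - c * h T) * (f (Y v ω) - c * h T) ∂μ
        ≤ (m T - c * h T) ^ 2 + D * h T * |ρ (v - u)| := by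
      intro u v hu hv
      have h1 := integral_mul_comp_le_of_map_linear (hYs u) (hYs v) (abs_le.mpr (hρbdd (v - u)))
        (hgauss u v hu hv) hfm (fun y => hKnn _) (fun y => hKB _) hfM hfint
      rw [hfI] at h1
      change _ ≤ m T ^ 2 + _ * m T * _ at h1
      have hprod : Integrable (fun ω => f (Y u ω) * f (Y v ω)) μ :=
        (hfYint v).bdd_mul (hfYint u).aestronglyMeasurable (ae_of_all _ fun ω => hB _)
      have h2 : ∫ ω, (f (Y u ω) - c * h T) * (f (Y v ω) - c * h T) ∂μ
          = (∫ ω, f (Y u ω) * f (Y v ω) ∂μ) - 2 * (c * h T) * m T + (c * h T) ^ 2 := by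
        have h3 : ∀ ω, (f (Y u ω) - c * h T) * (f (Y v ω) - c * h T)
            = f (Y u ω) * f (Y v ω) - c * h T * (f (Y u ω) + f (Y v ω)) + (c * h T) ^ 2 :=
          fun ω => by ring
        simp_rw [h3]
        have h4 := (((hfYint u).add (hfYint v)).const_mul (c * h T))
        simp only [Pi.add_apply] at h4
        have h6 : Integrable (fun ω => f (Y u ω) * f (Y v ω)
            - c * h T * (f (Y u ω) + f (Y v ω))) μ := hprod.sub h4
        rw [integral_add h6 (integrable_const _), integral_sub hprod h4,
          integral_const_mul, integral_add (hfYint u) (hfYint v), hlaw u hu, hlaw v hv,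
          integral_const]
        simp only [probReal_univ, one_smul]
        ring
      have h5 : (2 * B + (2 * M ^ 2 + 2) * (h T / σ₀)) * m T * |ρ (v - u)|
          ≤ D * h T * |ρ (v - u)| := by
        refine mul_le_mul_of_nonneg_right ?_ (abs_nonneg _)
        calc _ ≤ (2 * B + (2 * M ^ 2 + 2) * (1 / σ₀)) * (h T / σ₀) := by gcongr
          _ = D * h T := by rw [hD]; ring
      rw [h2]
      linarith
    have hρi : Integrable (fun p : ℝ × ℝ => |ρ (p.2 - p.1)|)
        ((volume.restrict (Ioc 0 T)).prod (volume.restrict (Ioc 0 T))) :=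
      Integrable.of_bound (C := 1)
        (Measurable.aestronglyMeasurable (by fun_prop)) (ae_of_all _ fun p => by
          simpa using abs_le.mpr (hρbdd (p.2 - p.1)))
    have hcheb := sq_mul_measureReal_le_abs_integral_le (τ := volume.restrict (Ioc 0 T)) (μ := μ)
      (F := fun s ω => f (Y s ω) - c * h T) (B := B + |c * h T|)
      (R := fun p => (m T - c * h T) ^ 2 + D * h T * |ρ (p.2 - p.1)|)
      ((hfm.comp hYmeas).sub_const _)
      (fun s ω => (abs_sub _ _).trans (add_le_add_left (hB _) _))
      ((integrable_const _).add (hρi.const_mul _))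
      (by
        rw [Measure.prod_restrict]
        filter_upwards [ae_restrict_mem (measurableSet_Ioc.prod measurableSet_Ioc)] with p hp
        exact hcov p.1 p.2 hp.1.1.le hp.2.1.le)
      (ε := ε * (T * h T)) (by positivity)
    have hRint : ∫ p, ((m T - c * h T) ^ 2 + D * h T * |ρ (p.2 - p.1)|)
        ∂((volume.restrict (Ioc 0 T)).prod (volume.restrict (Ioc 0 T)))
        = T ^ 2 * (m T - c * h T) ^ 2 + D * h T * J T := by
      rw [integral_add (integrable_const _) (hρi.const_mul _), integral_const, integral_const_mul,
        integral_prod _ hρi]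
      congr 1
      · rw [← univ_prod_univ, measureReal_prod_prod]
        simp only [measureReal_restrict_apply_univ, Real.volume_real_Ioc_of_le hT.le, smul_eq_mul]
        ring
      · simp only [hJ, intervalIntegral.integral_of_le hT.le]
    rw [hRint] at hcheb
    have hset : {ω | ε ≤ ‖(1 / (T * h T)) * (∫ s in (0 : ℝ)..T, K ((σ₀ * Y s ω - x) / h T)) - c‖}
        = {ω | ε * (T * h T) ≤ |∫ s in Ioc 0 T, (f (Y s ω) - c * h T)|} := by
      ext ω
      have hi : Integrable (fun s => f (Y s ω)) (volume.restrict (Ioc 0 T)) :=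
        Integrable.of_bound (hfm.comp (hYmeas.comp measurable_prodMk_right)).aestronglyMeasurable
          B (ae_of_all _ fun a => hB _)
      have h1 : (1 / (T * h T)) * (∫ s in (0 : ℝ)..T, K ((σ₀ * Y s ω - x) / h T)) - c
          = (∫ s in Ioc 0 T, (f (Y s ω) - c * h T)) / (T * h T) := by
        rw [intervalIntegral.integral_of_le hT.le, integral_sub hi (integrable_const _),
          integral_const]
        simp only [measureReal_restrict_apply_univ, Real.volume_real_Ioc_of_le hT.le, smul_eq_mul,
          hf]
        field_simp
        ring
      rw [mem_ofPred_eq, mem_ofPred_eq, h1, Real.norm_eq_abs, abs_div,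
        abs_of_pos (by positivity : 0 < T * h T), le_div_iff₀ (by positivity)]
    rw [hset, le_div_iff₀ (by positivity)]
    have h6 : ((m T / h T - c) ^ 2 + D * (J T / (T ^ 2 * h T)))
        = (T ^ 2 * (m T - c * h T) ^ 2 + D * h T * J T) / (T * h T) ^ 2 := by
      field_simp
    rw [h6, le_div_iff₀ (by positivity)]
    calc _ = _ := by ring
      _ ≤ _ := hcheb
  have hJlim : Tendsto (fun T => J T / (T ^ 2 * h T)) atTop (𝓝 0) := by
    have h1 : (fun T : ℝ => J T / T ^ 2) =O[atTop] fun T => T ^ (2 * H - 2) := by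
      refine (hρO.mul (isBigO_refl (fun T : ℝ => (T ^ 2)⁻¹) atTop)).congr' (by rfl) ?_
      filter_upwards [eventually_gt_atTop 0] with T hT
      rw [Real.rpow_sub hT, Real.rpow_two, div_eq_mul_inv]
    have h2 := (h1.trans_isLittleO hlittleo).tendsto_div_nhds_zero
    refine h2.congr fun T => ?_
    rw [div_div]
  rw [tendstoInMeasure_iff_measureReal_norm]
  intro ε hε
  refine squeeze_zero' (Eventually.of_forall fun T => measureReal_nonneg) (hbound ε hε) ?_
  have := (((hmean.sub_const c).pow 2).add (hJlim.const_mul D)).div_const (ε ^ 2)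
  simpa using this
end
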